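/- arXiv:2204.03274 — 2 statements merged into one kernel-verified Lean document; each statement's English description precedes it below -/
import Mathlib

section
/- Fix λ ∈ (0,1]. Let (P_n) be a sequence of positive reals with P_n → ∞, and for each n let φ_n be a continuous P_n-periodic solution of the steady Whitham equation with wave speed μ_n ∈ (0,1] such that φ_n is even, strictly increasing on (−P_n/2, 0), and satisfies μ_n − 1 ≤ φ_n(x) ≤ φ_n(0) = λμ_n/2 for all x. Then there exist a subsequence (n_k), a number ν ∈ [0,1], and a continuous function φ : ℝ → ℝ such that μ_{n_k} → ν, φ_{n_k} → φ uniformly on every compact subset of ℝ, φ solves the steady Whitham equation with wave speed ν, ν − 1 ≤ φ(x) ≤ λν/2 for all x with φ(0) = λν/2, and φ is even, nonconstant, nonperiodic, and strictly increasing on (−∞, 0]. -/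
open Real Filter MeasureTheory

/-- The Whitham symbol `m(ξ) = √(tanh ξ / ξ)`, with `m 0 = 1`. -/
noncomputable def whithamSymbol (ξ : ℝ) : ℝ :=
  if ξ = 0 then 1 else Real.sqrt (Real.tanh ξ / ξ)

/-- The Whitham kernel, defined for `x ≠ 0` as the improper integral
`K(x) = (1/π)·lim_{R→∞} ∫₀^R m(ξ) cos(xξ) dξ`, and `K 0 = 0`. -/
noncomputable def whithamKernel (x : ℝ) : ℝ :=
  if x = 0 then 0 else
    limUnder atTop
      (fun R : ℝ => (1 / Real.pi) * ∫ ξ in (0:ℝ)..R, whithamSymbol ξ * Real.cos (x * ξ))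

/-- The convolution operator `Lf(x) = ∫_ℝ K(x−y) f(y) dy`. -/
noncomputable def Lop (K f : ℝ → ℝ) (x : ℝ) : ℝ := ∫ y : ℝ, K (x - y) * f y

section

open scoped unitInterval NNReal Topology FourierTransform

/-- Functions of the form `ξ ↦ ∫ dτ(p) / (1 + p² ξ²)` with `τ` a finite measure on `[0, 1]`. -/
def IsStieltjes (f : ℝ → ℝ) : Prop :=
  ∃ τ : FiniteMeasure I, ∀ ξ, f ξ = ∫ p : I, (1 + (p : ℝ) ^ 2 * ξ ^ 2)⁻¹ ∂(τ : Measure I)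

lemma continuous_inv_one_add_sq_mul_sq (ξ : ℝ) :
    Continuous fun p : I => (1 + (p : ℝ) ^ 2 * ξ ^ 2)⁻¹ :=
  Continuous.inv₀ (by fun_prop) fun p => by positivity

lemma integrable_inv_one_add_sq_mul_sq (τ : Measure I) [IsFiniteMeasure τ] (ξ : ℝ) :
    Integrable (fun p : I => (1 + (p : ℝ) ^ 2 * ξ ^ 2)⁻¹) τ :=
  (continuous_inv_one_add_sq_mul_sq ξ).integrable_of_hasCompactSupport
    (HasCompactSupport.of_compactSpace _)

namespace IsStieltjes

lemma add {f g : ℝ → ℝ} (hf : IsStieltjes f) (hg : IsStieltjes g) :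
    IsStieltjes fun ξ => f ξ + g ξ := by
  obtain ⟨τ, hτ⟩ := hf
  obtain ⟨ρ, hρ⟩ := hg
  refine ⟨τ + ρ, fun ξ => ?_⟩
  rw [FiniteMeasure.toMeasure_add, integral_add_measure (integrable_inv_one_add_sq_mul_sq _ _)
    (integrable_inv_one_add_sq_mul_sq _ _)]
  exact congrArg₂ (· + ·) (hτ ξ) (hρ ξ)

lemma const_mul {f : ℝ → ℝ} (hf : IsStieltjes f) {c : ℝ} (hc : 0 ≤ c) :
    IsStieltjes fun ξ => c * f ξ := by
  obtain ⟨τ, hτ⟩ := hf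
  lift c to ℝ≥0 using hc
  refine ⟨c • τ, fun ξ => ?_⟩
  simp only [FiniteMeasure.toMeasure_smul, integral_smul_nnreal_measure, hτ]
  rfl

lemma zero : IsStieltjes fun _ => 0 := ⟨0, by simp⟩

lemma sum {ι : Type*} (s : Finset ι) {f : ι → ℝ → ℝ} (hf : ∀ i ∈ s, IsStieltjes (f i)) :
    IsStieltjes fun ξ => ∑ i ∈ s, f i ξ := by
  classical
  induction s using Finset.induction_on with
  | empty => simpa using zero
  | insert a s ha ih =>
    simp only [Finset.sum_insert ha]
    exact (hf a (by simp)).add (ih fun i hi => hf i (by simp [hi]))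

lemma inv_add_sq {a : ℝ} (ha : 1 ≤ a) : IsStieltjes fun ξ => (a + ξ ^ 2)⁻¹ := by
  have h0 : 0 < a := by linarith
  have h1 : √a⁻¹ ∈ Set.Icc (0 : ℝ) 1 :=
    ⟨sqrt_nonneg _, Real.sqrt_le_one.2 (inv_le_one_of_one_le₀ ha)⟩
  have h : IsStieltjes fun ξ => (1 + (√a⁻¹) ^ 2 * ξ ^ 2)⁻¹ :=
    ⟨⟨Measure.dirac ⟨√a⁻¹, h1⟩, inferInstance⟩, fun ξ => by simp⟩
  convert h.const_mul (inv_nonneg.2 h0.le) using 2 with ξ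
  rw [Real.sq_sqrt (by positivity)]
  field_simp

lemma of_tendsto {F : ℕ → ℝ → ℝ} {f : ℝ → ℝ} (hF : ∀ n, IsStieltjes (F n))
    (h : ∀ ξ, Tendsto (fun n => F n ξ) atTop (𝓝 (f ξ))) : IsStieltjes f := by
  choose τ hτ using hF
  have hmass : ∀ n, F n 0 = ((τ n).mass : ℝ) := fun n => by
    rw [hτ]
    simp only [ne_eq, OfNat.ofNat_ne_zero, not_false_eq_true, zero_pow, mul_zero, add_zero,
      inv_one, integral_const, smul_eq_mul, mul_one]
    rfl
  obtain ⟨C, hC⟩ := (h 0).bddAbove_range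
  have hC0 : ∀ n, (τ n).mass ≤ C.toNNReal := fun n => by
    rw [← NNReal.coe_le_coe, ← hmass]
    exact (hC ⟨n, rfl⟩).trans (le_coe_toNNReal C)
  obtain ⟨ρ, -, hρ⟩ := (isCompact_setOfPred_finiteMeasure_le_of_compactSpace I C.toNNReal)
    |>.ultrafilter_le_nhds ((hyperfilter ℕ).map τ) (by
      rw [Filter.le_principal_iff, Ultrafilter.coe_map, mem_map]
      exact Filter.univ_mem' hC0)
  refine ⟨ρ, fun ξ => ?_⟩
  have h1 : Tendsto τ (hyperfilter ℕ) (𝓝 ρ) := hρ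
  have h2 := (FiniteMeasure.tendsto_iff_forall_integral_tendsto.1 h1)
    (BoundedContinuousFunction.mkOfCompact ⟨_, continuous_inv_one_add_sq_mul_sq ξ⟩)
  have h3 : Tendsto (fun n => F n ξ) (hyperfilter ℕ) (𝓝 (f ξ)) :=
    (h ξ).mono_left Nat.hyperfilter_le_atTop
  refine tendsto_nhds_unique h3 ?_
  simp only [hτ]
  exact h2

end IsStieltjes

/-- A diagonal operator plus the rank one operator `r v vᵀ`. -/
noncomputable def rankOnePerturbation {ι : Type*} [Fintype ι] (b : ι → ℝ)
    (v : EuclideanSpace ℝ ι) (r : ℝ) : EuclideanSpace ℝ ι →ₗ[ℝ] EuclideanSpace ℝ ι where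
  toFun x := WithLp.toLp 2 fun i => b i * x i + r * inner ℝ v x * v i
  map_add' x y := by
    ext i
    simp only [PiLp.add_apply, inner_add_right]
    ring
  map_smul' c x := by
    ext i
    simp only [PiLp.smul_apply, inner_smul_right, smul_eq_mul, RingHom.id_apply]
    ring

section RankOne

variable {ι : Type*} [Fintype ι] (b : ι → ℝ) (v : EuclideanSpace ℝ ι) (r : ℝ)

lemma rankOnePerturbation_apply (x : EuclideanSpace ℝ ι) (i : ι) :
    rankOnePerturbation b v r x i = b i * x i + r * inner ℝ v x * v i := rfl

lemma inner_rankOnePerturbation (x y : EuclideanSpace ℝ ι) :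
    inner ℝ x (rankOnePerturbation b v r y) =
      ∑ i, b i * x i * y i + r * inner ℝ v x * inner ℝ v y := by
  have h : inner ℝ v x = ∑ i, x i * v i := by simp [PiLp.inner_apply]
  rw [h, PiLp.inner_apply, Finset.mul_sum, Finset.sum_mul, ← Finset.sum_add_distrib]
  refine Finset.sum_congr rfl fun i _ => ?_
  simp only [rankOnePerturbation_apply, RCLike.inner_apply, conj_trivial]
  ring

lemma isSymmetric_rankOnePerturbation : (rankOnePerturbation b v r).IsSymmetric := by
  intro x y
  rw [real_inner_comm, inner_rankOnePerturbation, inner_rankOnePerturbation]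
  congr 1
  · exact Finset.sum_congr rfl fun i _ => by ring
  · ring

end RankOne

lemma IsStieltjes.finite_sum_div_one_add {ι : Type*} [Fintype ι] {b : ι → ℝ} (hb : ∀ i, 1 ≤ b i)
    (v : EuclideanSpace ℝ ι) {r : ℝ} (hr : 0 ≤ r) :
    IsStieltjes fun ξ => (∑ i, v i ^ 2 / (b i + ξ ^ 2)) /
      (1 + r * ∑ i, v i ^ 2 / (b i + ξ ^ 2)) := by
  have hT := isSymmetric_rankOnePerturbation b v r
  set T := rankOnePerturbation b v r with hTdef
  obtain ⟨n, hn⟩ : ∃ n, Module.finrank ℝ (EuclideanSpace ℝ ι) = n := ⟨_, rfl⟩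
  set e := hT.eigenvectorBasis hn
  set l := hT.eigenvalues hn
  have hTe : ∀ k, T (e k) = l k • e k := fun k => hT.apply_eigenvectorBasis hn k
  have hl1 : ∀ k, 1 ≤ l k := fun k => by
    have h1 : inner ℝ (e k) (T (e k)) = l k := by
      rw [hTe, inner_smul_right, real_inner_self_eq_norm_sq, e.norm_eq_one]; simp
    have h2 : ∑ i, e k i * e k i = 1 := by
      have := real_inner_self_eq_norm_sq (e k)
      rw [e.norm_eq_one, PiLp.inner_apply] at this
      simpa [← pow_two] using this
    rw [← h1, hTdef, inner_rankOnePerturbation, ← h2]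
    have h3 : 0 ≤ r * inner ℝ v (e k) * inner ℝ v (e k) := by
      rw [mul_assoc]; exact mul_nonneg hr (mul_self_nonneg _)
    have h4 : ∑ i, e k i * e k i ≤ ∑ i, b i * e k i * e k i :=
      Finset.sum_le_sum fun i _ => by nlinarith [hb i, mul_self_nonneg (e k i)]
    linarith
  have key : IsStieltjes fun ξ => ∑ k, (inner ℝ (e k) v) ^ 2 * (l k + ξ ^ 2)⁻¹ :=
    IsStieltjes.sum _ fun k _ => (IsStieltjes.inv_add_sq (hl1 k)).const_mul (sq_nonneg _)
  convert key using 2 with ξ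
  set F := ∑ i, v i ^ 2 / (b i + ξ ^ 2) with hF
  set y := ∑ k, (inner ℝ (e k) v * (l k + ξ ^ 2)⁻¹) • e k with hy
  have hpos : ∀ k, l k + ξ ^ 2 ≠ 0 := fun k => by nlinarith [hl1 k, sq_nonneg ξ]
  have hbpos : ∀ i, b i + ξ ^ 2 ≠ 0 := fun k => by nlinarith [hb k, sq_nonneg ξ]
  have hTy : T y + ξ ^ 2 • y = v := by
    conv_rhs => rw [← e.sum_repr' v]
    rw [hy, map_sum, Finset.smul_sum, ← Finset.sum_add_distrib]
    refine Finset.sum_congr rfl fun k _ => ?_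
    rw [map_smul, hTe, smul_smul, smul_smul, ← add_smul]
    congr 1
    field_simp [hpos k]
  have hα : inner ℝ v y = ∑ k, (inner ℝ (e k) v) ^ 2 * (l k + ξ ^ 2)⁻¹ := by
    rw [hy, inner_sum]
    refine Finset.sum_congr rfl fun k _ => ?_
    rw [inner_smul_right, real_inner_comm]
    ring
  rw [← hα]
  have hyi : ∀ i, y i = (1 - r * inner ℝ v y) * (v i / (b i + ξ ^ 2)) := fun i => by
    have := congrArg (fun z : EuclideanSpace ℝ ι => z i) hTy
    simp only [PiLp.add_apply, PiLp.smul_apply, smul_eq_mul, hTdef,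
      rankOnePerturbation_apply] at this
    rw [← mul_div_assoc, eq_div_iff (hbpos i)]
    linarith
  have h5 : inner ℝ v y = (1 - r * inner ℝ v y) * F := by
    conv_lhs => rw [PiLp.inner_apply]
    rw [hF, Finset.mul_sum]
    refine Finset.sum_congr rfl fun i _ => ?_
    rw [RCLike.inner_apply, hyi i, conj_trivial]
    ring
  have hF0 : 0 ≤ F := Finset.sum_nonneg fun i _ =>
    div_nonneg (sq_nonneg _) (by nlinarith [hb i, sq_nonneg ξ])
  have h6 : 0 < 1 + r * F := by positivity
  rw [div_eq_iff h6.ne']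
  linarith

lemma HasSum.of_eq {E : Type*} [AddCommMonoid E] [TopologicalSpace E] {f g : ℕ → E} {a b : E}
    (h : HasSum f a) (hf : ∀ n, g n = f n) (hb : b = a) : HasSum g b := by
  rwa [hb, show g = f from funext hf]

lemma hasSum_coth_sub_inv {ξ : ℝ} (hξ : ξ ≠ 0) :
    HasSum (fun n : ℕ => 2 * ξ / (ξ ^ 2 + ((n + 1) * π) ^ 2)) (cosh ξ / sinh ξ - 1 / ξ) := by
  have hπ : (π : ℂ) ≠ 0 := by exact_mod_cast pi_ne_zero
  have hI := Complex.I_ne_zero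
  have hξ' : (ξ : ℂ) ≠ 0 := by exact_mod_cast hξ
  set x : ℂ := ξ * Complex.I / π with hx
  have hxmem : x ∈ Complex.integerComplement := by
    rintro ⟨n, hn⟩
    have h := congrArg Complex.im hn
    have h2 : x = ((ξ / π : ℝ) : ℂ) * Complex.I := by rw [hx]; push_cast; ring
    rw [h2, Complex.im_ofReal_mul, Complex.I_im, Complex.intCast_im] at h
    exact (div_ne_zero hξ pi_ne_zero) (by linarith)
  have h1 := (summable_cotTerm hxmem).hasSum
  have h2 := cot_series_rep' hxmem
  simp only [cotTerm] at h1
  rw [← h2] at h1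
  have h3 := h1.mul_left (Complex.I / π)
  rw [← Complex.hasSum_ofReal]
  have hsinh : Complex.sinh ξ ≠ 0 := by
    rw [← Complex.ofReal_sinh]; exact_mod_cast (Real.sinh_eq_zero.not.2 hξ)
  refine h3.of_eq (fun n => ?_) ?_
  · have h4 : ((ξ : ℂ) ^ 2 + ((n + 1) * π) ^ 2) ≠ 0 := by
      have : 0 < ξ ^ 2 + ((n + 1) * π) ^ 2 := by positivity
      exact_mod_cast this.ne'
    have h5 : x - (n + 1) ≠ 0 := fun h => by
      apply hxmem; exact ⟨n + 1, by push_cast; linear_combination -h⟩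
    have h6 : x + (n + 1) ≠ 0 := fun h => by
      apply hxmem; exact ⟨-(n + 1), by push_cast; linear_combination -h⟩
    have h7 : (x - (n + 1)) * (x + (n + 1)) = -((ξ : ℂ) ^ 2 + ((n + 1) * π) ^ 2) / π ^ 2 := by
      rw [hx]; field_simp; ring_nf; rw [Complex.I_sq]; ring
    have h8 : 1 / (x - (n + 1)) + 1 / (x + (n + 1)) = 2 * x / ((x - (n + 1)) * (x + (n + 1))) := by
      field_simp; ring
    rw [h8, h7, hx]
    push_cast
    field_simp
    rw [Complex.I_sq]
    ring
  · have h9 : (π : ℂ) * x = ξ * Complex.I := by rw [hx]; field_simp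
    rw [h9, Complex.cot, Complex.cos_mul_I, Complex.sin_mul_I, hx]
    push_cast
    field_simp

lemma hasSum_tanh_div {ξ : ℝ} (hξ : ξ ≠ 0) :
    HasSum (fun n : ℕ => 2 / (((2 * n + 1) * (π / 2)) ^ 2 + ξ ^ 2)) (tanh ξ / ξ) := by
  have h1 := hasSum_coth_sub_inv hξ
  have h2 := (hasSum_coth_sub_inv (mul_ne_zero two_ne_zero hξ)).mul_left 2
  set g : ℕ → ℝ := fun n => 2 * (2 * (2 * ξ) / ((2 * ξ) ^ 2 + ((n + 1) * π) ^ 2)) with hg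
  have hodd : Summable fun n : ℕ => g (2 * n) :=
    h2.summable.comp_injective (i := fun n : ℕ => 2 * n) fun a b h => by simpa using h
  have heven : HasSum (fun n : ℕ => g (2 * n + 1)) (cosh ξ / sinh ξ - 1 / ξ) := by
    refine h1.of_eq (fun n => ?_) rfl
    simp only [hg]
    push_cast
    have : 0 < ξ ^ 2 + ((n + 1) * π) ^ 2 := by positivity
    have h' : 0 < (2 * ξ) ^ 2 + ((2 * (n : ℝ) + 1 + 1) * π) ^ 2 := by positivity
    rw [mul_div_assoc', div_eq_div_iff h'.ne' this.ne']
    ring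
  have h3 := (HasSum.even_add_odd (f := g) hodd.hasSum heven).unique h2
  have hs : sinh ξ ≠ 0 := Real.sinh_eq_zero.not.2 hξ
  have hc : cosh ξ ≠ 0 := (cosh_pos ξ).ne'
  have h4 := hodd.hasSum
  rw [eq_sub_of_add_eq h3, Real.cosh_two_mul, Real.sinh_two_mul] at h4
  refine (h4.mul_left ξ⁻¹).of_eq (fun n => ?_) ?_
  · simp only [hg]
    push_cast
    have : 0 < ((2 * n + 1) * (π / 2)) ^ 2 + ξ ^ 2 := by positivity
    have h' : 0 < (2 * ξ) ^ 2 + ((2 * (n : ℝ) + 1) * π) ^ 2 := by positivity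
    field_simp
    ring
  · rw [Real.tanh_eq_sinh_div_cosh]
    field_simp
    ring

lemma hasSum_tanh_div_zero :
    HasSum (fun n : ℕ => 2 / (((2 * n + 1) * (π / 2)) ^ 2)) 1 := by
  have h1 := hasSum_zeta_two
  set g : ℕ → ℝ := fun n => 1 / (n : ℝ) ^ 2 with hg
  have hodd : Summable fun n : ℕ => g (2 * n + 1) :=
    h1.summable.comp_injective (i := fun n : ℕ => 2 * n + 1) fun a b h => by simpa using h
  have heven : HasSum (fun n : ℕ => g (2 * n)) (4⁻¹ * (π ^ 2 / 6)) := by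
    refine (h1.mul_left 4⁻¹).of_eq (fun n => ?_) rfl
    simp only [hg]
    push_cast
    rw [mul_pow, one_div, one_div, mul_inv]
    norm_num
  have h3 := (HasSum.even_add_odd (f := g) heven hodd.hasSum).unique h1
  have h4 := hodd.hasSum
  rw [eq_sub_of_add_eq' h3] at h4
  refine (h4.mul_left (8 / π ^ 2)).of_eq (fun n => ?_) ?_
  · simp only [hg]
    push_cast
    field_simp
    norm_num
  · field_simp
    norm_num

lemma whithamSymbol_nonneg (ξ : ℝ) : 0 ≤ whithamSymbol ξ := by
  unfold whithamSymbol; split_ifs <;> positivity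

lemma hasSum_whithamSymbol_sq (ξ : ℝ) :
    HasSum (fun n : ℕ => 2 / (((2 * n + 1) * (π / 2)) ^ 2 + ξ ^ 2)) (whithamSymbol ξ ^ 2) := by
  unfold whithamSymbol
  split_ifs with h
  · simpa [h] using hasSum_tanh_div_zero
  · have h1 := hasSum_tanh_div h
    rwa [Real.sq_sqrt (h1.nonneg fun n => by positivity)]

lemma whithamSymbol_pos (ξ : ℝ) : 0 < whithamSymbol ξ := by
  have h := hasSum_whithamSymbol_sq ξ
  have h1 : 0 < whithamSymbol ξ ^ 2 := by
    rw [← h.tsum_eq]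
    exact h.summable.tsum_pos (fun n => by positivity) 0 (by positivity)
  exact lt_of_le_of_ne (whithamSymbol_nonneg ξ) fun h0 => by simp [← h0] at h1

lemma isStieltjes_whithamSymbol_sq_div {r : ℝ} (hr : 0 ≤ r) :
    IsStieltjes fun ξ => whithamSymbol ξ ^ 2 / (1 + r * whithamSymbol ξ ^ 2) := by
  have hb : ∀ n : ℕ, 1 ≤ ((2 * n + 1) * (π / 2)) ^ 2 := fun n => by
    have h1 : 1 ≤ (2 * (n : ℝ) + 1) * (π / 2) := by
      nlinarith [pi_gt_three, (Nat.cast_nonneg n : (0 : ℝ) ≤ n)]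
    nlinarith
  refine IsStieltjes.of_tendsto (fun N => IsStieltjes.finite_sum_div_one_add
    (fun i : Fin N => hb i) (WithLp.toLp 2 fun _ => √2) hr) fun ξ => ?_
  have h := (hasSum_whithamSymbol_sq ξ).tendsto_sum_nat
  have h1 : ∀ N : ℕ, ∑ i : Fin N, (√2) ^ 2 / (((2 * (i : ℕ) + 1) * (π / 2)) ^ 2 + ξ ^ 2) =
      ∑ i ∈ Finset.range N, 2 / (((2 * (i : ℝ) + 1) * (π / 2)) ^ 2 + ξ ^ 2) := fun N => by
    rw [Finset.sum_range, Real.sq_sqrt (by norm_num)]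
  refine (h.div (tendsto_const_nhds.add (h.const_mul r)) (by positivity)).congr fun N => ?_
  simp only [← h1]
  rfl

lemma integral_div_add_sq {s : ℝ} (hs : 0 < s) {c : ℝ} (hc : 0 < c) (b : ℝ) :
    ∫ x in (0 : ℝ)..b, c * (s ^ 2 / (s ^ 2 + (x * c) ^ 2)) = s * arctan (b * c / s) := by
  have hd : ∀ x ∈ Set.uIcc 0 b, HasDerivAt (fun x => s * arctan (x * c / s))
      (c * (s ^ 2 / (s ^ 2 + (x * c) ^ 2))) x := fun x _ => by
    refine ((((hasDerivAt_id x).mul_const c).div_const s).arctan.const_mul s).congr_deriv ?_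
    simp only [id]
    field_simp
  rw [intervalIntegral.integral_eq_sub_of_hasDerivAt hd]
  · simp only [zero_mul, zero_div, arctan_zero, mul_zero, sub_zero]
  · refine Continuous.intervalIntegrable ?_ _ _
    exact continuous_const.mul (continuous_const.div (by fun_prop) fun x => by positivity)

lemma tendsto_riemann_sum_sqrt {s : ℝ} (hs : 0 < s) :
    Tendsto (fun M : ℕ => 2 / π * ∑ j ∈ Finset.range ((M + 1) ^ 2), 1 / (M + 1 : ℝ) *
      (s ^ 2 / (s ^ 2 + ((j + 1) * (1 / (M + 1 : ℝ))) ^ 2))) atTop (𝓝 s) := by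
  have hlim : Tendsto (fun M : ℕ => s * arctan ((M + 1) / s)) atTop (𝓝 (s * (π / 2))) := by
    refine Tendsto.const_mul s ?_
    refine (tendsto_nhds_of_tendsto_nhdsWithin tendsto_arctan_atTop).comp ?_
    exact (tendsto_atTop_add_const_right _ _ tendsto_natCast_atTop_atTop).atTop_div_const hs
  have hanti : ∀ M : ℕ, AntitoneOn (fun x : ℝ => 1 / (M + 1 : ℝ) *
      (s ^ 2 / (s ^ 2 + (x * (1 / (M + 1 : ℝ))) ^ 2))) (Set.Ici 0) := fun M x hx y hy hxy => by
    have hx0 : 0 ≤ x := hx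
    dsimp only
    gcongr
  have hint : ∀ M : ℕ, ∫ x in (0 : ℝ)..((M + 1) ^ 2 : ℕ), 1 / (M + 1 : ℝ) *
      (s ^ 2 / (s ^ 2 + (x * (1 / (M + 1 : ℝ))) ^ 2)) = s * arctan ((M + 1) / s) := fun M => by
    rw [integral_div_add_sq hs (by positivity)]
    congr 3
    push_cast
    field_simp
  have hup : ∀ M : ℕ, ∑ j ∈ Finset.range ((M + 1) ^ 2), 1 / (M + 1 : ℝ) *
      (s ^ 2 / (s ^ 2 + ((j + 1) * (1 / (M + 1 : ℝ))) ^ 2)) ≤ s * arctan ((M + 1) / s) :=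
    fun M => by
      have := AntitoneOn.sum_le_integral (x₀ := 0) (a := (M + 1) ^ 2)
        ((hanti M).mono (Set.Icc_subset_Ici_self))
      rw [zero_add, hint] at this
      simpa using this
  have hlow : ∀ M : ℕ, s * arctan ((M + 1) / s) - 1 / (M + 1 : ℝ) ≤
      ∑ j ∈ Finset.range ((M + 1) ^ 2), 1 / (M + 1 : ℝ) *
      (s ^ 2 / (s ^ 2 + ((j + 1) * (1 / (M + 1 : ℝ))) ^ 2)) :=
    fun M => by
      have := AntitoneOn.integral_le_sum (x₀ := 0) (a := (M + 1) ^ 2)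
        ((hanti M).mono (Set.Icc_subset_Ici_self))
      rw [zero_add, hint] at this
      have h2 := Finset.sum_range_succ' (fun j : ℕ => 1 / (M + 1 : ℝ) *
        (s ^ 2 / (s ^ 2 + (j * (1 / (M + 1 : ℝ))) ^ 2))) ((M + 1) ^ 2)
      rw [Finset.sum_range_succ] at h2
      have h3 : 0 ≤ 1 / (M + 1 : ℝ) *
        (s ^ 2 / (s ^ 2 + ((((M + 1) ^ 2 : ℕ) : ℝ) * (1 / (M + 1 : ℝ))) ^ 2)) := by positivity
      have h4 : 1 / (M + 1 : ℝ) * (s ^ 2 / (s ^ 2 + (((0 : ℕ) : ℝ) * (1 / (M + 1 : ℝ))) ^ 2)) =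
          1 / (M + 1 : ℝ) := by
        have : s ^ 2 ≠ 0 := by positivity
        simp [this]
      rw [h4] at h2
      simp only [zero_add] at this
      simp only [Nat.cast_add, Nat.cast_one] at h2
      push_cast at *
      linarith
  have hlim2 : Tendsto (fun M : ℕ => s * arctan ((M + 1) / s) - 1 / (M + 1 : ℝ)) atTop
      (𝓝 (s * (π / 2))) := by
    simpa using hlim.sub tendsto_one_div_add_atTop_nhds_zero_nat
  convert (tendsto_of_tendsto_of_tendsto_of_le_of_le hlim2 hlim hlow hup).const_mul (2 / π) using 2
  field_simp

theorem isStieltjes_whithamSymbol : IsStieltjes whithamSymbol := by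
  refine IsStieltjes.of_tendsto (F := fun M ξ => 2 / π * ∑ j ∈ Finset.range ((M + 1) ^ 2),
    1 / (M + 1 : ℝ) * (whithamSymbol ξ ^ 2 /
      (whithamSymbol ξ ^ 2 + ((j + 1) * (1 / (M + 1 : ℝ))) ^ 2))) (fun M => ?_)
    fun ξ => tendsto_riemann_sum_sqrt (whithamSymbol_pos ξ)
  refine IsStieltjes.const_mul (IsStieltjes.sum _ fun j _ => IsStieltjes.const_mul ?_ ?_) ?_
  · set q : ℝ := (j + 1) * (1 / (M + 1 : ℝ)) with hq
    have hq0 : 0 < q := by positivity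
    convert (isStieltjes_whithamSymbol_sq_div (r := (q ^ 2)⁻¹) (by positivity)).const_mul
      (c := (q ^ 2)⁻¹) (by positivity) using 2 with ξ
    have := whithamSymbol_pos ξ
    field_simp
    ring
  · positivity
  · positivity

/-- The Whitham symbol is a mixture of the symbols `1 / (1 + p² ξ²)`. -/
theorem exists_probabilityMeasure_whithamSymbol :
    ∃ τ : Measure I, IsProbabilityMeasure τ ∧ (∀ᵐ p : I ∂τ, (0 : ℝ) < p) ∧
      ∀ ξ, whithamSymbol ξ = ∫ p : I, (1 + (p : ℝ) ^ 2 * ξ ^ 2)⁻¹ ∂τ := by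
  obtain ⟨τ, hτ⟩ := isStieltjes_whithamSymbol
  refine ⟨τ, ⟨?_⟩, ?_, hτ⟩
  · have h := hτ 0
    simp only [whithamSymbol, if_true, ne_eq, OfNat.ofNat_ne_zero, not_false_eq_true, zero_pow,
      mul_zero, add_zero, inv_one, integral_const, smul_eq_mul, mul_one] at h
    rw [← ENNReal.toReal_eq_one_iff]
    exact h.symm
  · have hle : ∀ n : ℕ, (τ : Measure I).real {0} ^ 2 ≤ 1 / ((n : ℝ) + 1) := fun n => by
      have h0 : (τ : Measure I).real {0} ≤ whithamSymbol (n + 1) := by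
        rw [hτ, ← integral_indicator_one (measurableSet_singleton (0 : I))]
        refine integral_mono ?_ (integrable_inv_one_add_sq_mul_sq _ _) fun p => ?_
        · exact (integrable_const 1).indicator (measurableSet_singleton 0)
        · by_cases hp : p = 0
          · simp [hp]
          · have : 0 ≤ (1 + (p : ℝ) ^ 2 * ((n : ℝ) + 1) ^ 2)⁻¹ := by positivity
            simpa [hp] using this
      have h1 : whithamSymbol (n + 1) ^ 2 ≤ 1 / ((n : ℝ) + 1) := by
        have hn : (0 : ℝ) < n + 1 := by positivity
        rw [whithamSymbol, if_neg hn.ne', Real.sq_sqrt]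
        · gcongr; exact (Real.tanh_lt_one _).le
        · rw [Real.tanh_eq_sinh_div_cosh]
          exact div_nonneg (div_nonneg (Real.sinh_nonneg_iff.2 hn.le) (cosh_pos _).le) hn.le
      exact (pow_le_pow_left₀ measureReal_nonneg h0 2).trans h1
    have h2 : (τ : Measure I).real {0} ^ 2 ≤ 0 :=
      ge_of_tendsto' tendsto_one_div_add_atTop_nhds_zero_nat hle
    have h3 : (τ : Measure I) {0} = 0 := by
      have : (τ : Measure I).real {0} = 0 := pow_eq_zero_iff two_ne_zero |>.1
        (le_antisymm h2 (sq_nonneg _))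
      exact (measureReal_eq_zero_iff).1 this
    filter_upwards [compl_mem_ae_iff.2 h3] with p hp
    exact lt_of_le_of_ne p.2.1 fun h => hp (Subtype.ext h.symm)

lemma integrable_exp_neg_abs : Integrable fun x : ℝ => rexp (-|x|) := by
  rw [← integrableOn_univ, ← Set.Iic_union_Ioi (a := (0 : ℝ)), integrableOn_union]
  constructor
  · refine (integrableOn_exp_mul_Iic one_pos 0).congr_fun (fun x hx => ?_) measurableSet_Iic
    simp [abs_of_nonpos (Set.mem_Iic.1 hx)]
  · refine (integrableOn_exp_mul_Ioi (a := -1) (by norm_num) 0).congr_fun (fun x hx => ?_)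
      measurableSet_Ioi
    simp [abs_of_pos (Set.mem_Ioi.1 hx)]

lemma fourier_exp_neg_abs (w : ℝ) :
    𝓕 (fun x : ℝ => (rexp (-|x|) : ℂ)) w = ((2 * (1 + (2 * π * w) ^ 2)⁻¹ : ℝ) : ℂ) := by
  rw [Real.fourier_real_eq_integral_exp_smul]
  set a : ℂ := 1 - 2 * π * w * Complex.I with ha
  set b : ℂ := -1 - 2 * π * w * Complex.I with hb
  have hare : 0 < a.re := by simp [ha]
  have hbre : b.re < 0 := by simp [hb]
  have h1 : ∀ x ∈ Set.Iic (0 : ℝ), Complex.exp (a * x) =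
      Complex.exp (↑(-2 * π * x * w) * Complex.I) • (rexp (-|x|) : ℂ) := fun x hx => by
    rw [abs_of_nonpos (Set.mem_Iic.1 hx), smul_eq_mul, Complex.ofReal_exp, ← Complex.exp_add, ha]
    congr 1; push_cast; ring
  have h2 : ∀ x ∈ Set.Ioi (0 : ℝ), Complex.exp (b * x) =
      Complex.exp (↑(-2 * π * x * w) * Complex.I) • (rexp (-|x|) : ℂ) := fun x hx => by
    rw [abs_of_pos (Set.mem_Ioi.1 hx), smul_eq_mul, Complex.ofReal_exp, ← Complex.exp_add, hb]
    congr 1; push_cast; ring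
  rw [← intervalIntegral.integral_Iic_add_Ioi (b := 0)
    ((integrableOn_exp_mul_complex_Iic hare 0).congr_fun h1 measurableSet_Iic)
    ((integrableOn_exp_mul_complex_Ioi hbre 0).congr_fun h2 measurableSet_Ioi),
    ← setIntegral_congr_fun measurableSet_Iic h1, ← setIntegral_congr_fun measurableSet_Ioi h2,
    integral_exp_mul_complex_Iic hare, integral_exp_mul_complex_Ioi hbre]
  have ha0 : a ≠ 0 := fun h => by simp [h] at hare
  have hb0 : b ≠ 0 := fun h => by simp [h] at hbre
  have hab : a * -b = 1 + (2 * π * w) ^ 2 := by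
    rw [ha, hb]; ring_nf; rw [Complex.I_sq]; ring
  have h3 : a - b = 2 := by rw [ha, hb]; ring
  have h4 : (1 + (2 * π * w) ^ 2 : ℂ) ≠ 0 := hab ▸ mul_ne_zero ha0 (neg_ne_zero.2 hb0)
  push_cast
  rw [← hab] at h4 ⊢
  simp only [mul_zero, Complex.exp_zero]
  rw [← h3]
  field_simp
  ring

lemma integral_cos_div_one_add_sq (v : ℝ) :
    ∫ u : ℝ, cos (u * v) * (1 + u ^ 2)⁻¹ = π * rexp (-|v|) := by
  have hFint : Integrable (𝓕 fun x : ℝ => (rexp (-|x|) : ℂ)) := by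
    rw [show 𝓕 (fun x : ℝ => (rexp (-|x|) : ℂ)) =
      fun w => ((2 * (1 + (2 * π * w) ^ 2)⁻¹ : ℝ) : ℂ) from funext fourier_exp_neg_abs]
    exact ((integrable_inv_one_add_sq.comp_mul_left' (R := 2 * π) (by positivity)).const_mul
      2).ofReal
  have h := congrFun (Continuous.fourierInv_fourier_eq (f := fun x : ℝ => (rexp (-|x|) : ℂ))
    (by fun_prop) integrable_exp_neg_abs.ofReal hFint) v
  rw [Real.fourierInv_eq'] at h
  simp only [fourier_exp_neg_abs] at h
  have hre := congrArg Complex.re h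
  rw [← RCLike.re_to_complex, ← integral_re] at hre
  · have h2 : ∀ w : ℝ, RCLike.re (Complex.exp (↑(2 * π * inner ℝ w v) * Complex.I) •
        ((2 * (1 + (2 * π * w) ^ 2)⁻¹ : ℝ) : ℂ)) =
        2 * (fun u : ℝ => cos (u * v) * (1 + u ^ 2)⁻¹) (2 * π * w) := fun w => by
      rw [smul_eq_mul, RCLike.re_to_complex, Complex.re_mul_ofReal, Complex.exp_ofReal_mul_I_re]
      simp only [RCLike.inner_apply, conj_trivial]
      rw [show 2 * π * (v * w) = 2 * π * w * v by ring]
      ring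
    have h3 := Measure.integral_comp_mul_left (fun u : ℝ => cos (u * v) * (1 + u ^ 2)⁻¹) (2 * π)
    simp only [h2] at hre
    rw [integral_const_mul, h3,
      Complex.ofReal_re, abs_of_pos (by positivity), smul_eq_mul] at hre
    rw [← hre, ← mul_assoc, ← mul_assoc, show π * 2 * (2 * π)⁻¹ = 1 by field_simp, one_mul]
  · rw [show 𝓕 (fun x : ℝ => (rexp (-|x|) : ℂ)) =
      fun w => ((2 * (1 + (2 * π * w) ^ 2)⁻¹ : ℝ) : ℂ) from funext fourier_exp_neg_abs] at hFint
    refine hFint.norm.mono' (Continuous.aestronglyMeasurable ?_) (ae_of_all _ fun w => ?_)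
    · have hc : Continuous fun w : ℝ => (1 + (2 * π * w) ^ 2)⁻¹ :=
        Continuous.inv₀ (by fun_prop) fun w => by positivity
      fun_prop
    · rw [norm_smul, Complex.norm_exp_ofReal_mul_I, one_mul]

lemma tendsto_integral_cos_div_one_add_sq (v : ℝ) :
    Tendsto (fun R : ℝ => ∫ u in (0 : ℝ)..R, cos (u * v) * (1 + u ^ 2)⁻¹) atTop
      (𝓝 (π / 2 * rexp (-|v|))) := by
  have hint : Integrable fun u : ℝ => cos (u * v) * (1 + u ^ 2)⁻¹ :=
    integrable_inv_one_add_sq.mono' (Continuous.aestronglyMeasurable (by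
      have hc : Continuous fun w : ℝ => (1 + w ^ 2)⁻¹ :=
        Continuous.inv₀ (by fun_prop) fun w => by positivity
      fun_prop)) (ae_of_all _ fun u => by
        rw [norm_mul, norm_of_nonneg (r := (1 + u ^ 2)⁻¹) (by positivity)]
        exact mul_le_of_le_one_left (by positivity) (abs_cos_le_one _))
  have h := intervalIntegral_tendsto_integral_Ioi 0 hint.integrableOn tendsto_id
  have h2 := integral_comp_abs (f := fun u : ℝ => cos (u * v) * (1 + u ^ 2)⁻¹)
  have h3 : ∀ u : ℝ, cos (|u| * v) * (1 + |u| ^ 2)⁻¹ = cos (u * v) * (1 + u ^ 2)⁻¹ := fun u => by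
    rcases abs_cases u with ⟨h, -⟩ | ⟨h, -⟩ <;> simp [h]
  simp only [h3, integral_cos_div_one_add_sq] at h2
  rwa [show ∫ u in Set.Ioi (0 : ℝ), cos (u * v) * (1 + u ^ 2)⁻¹ = π / 2 * rexp (-|v|) by
    linarith] at h

lemma tendsto_integral_cos_inv_one_add_sq_mul_sq {p : ℝ} (hp : 0 < p) (x : ℝ) :
    Tendsto (fun R : ℝ => ∫ ξ in (0 : ℝ)..R, (1 + p ^ 2 * ξ ^ 2)⁻¹ * cos (x * ξ)) atTop
      (𝓝 (π * ((2 * p)⁻¹ * rexp (-(|x| / p))))) := by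
  have h := ((tendsto_integral_cos_div_one_add_sq (x / p)).comp
    (tendsto_id.const_mul_atTop hp)).const_mul p⁻¹
  rw [show π * ((2 * p)⁻¹ * rexp (-(|x| / p))) = p⁻¹ * (π / 2 * rexp (-|x / p|)) by
    rw [abs_div, abs_of_pos hp]; field_simp]
  refine h.congr fun R => ?_
  have h3 := intervalIntegral.integral_comp_mul_left (a := 0) (b := R)
    (fun u : ℝ => cos (u * (x / p)) * (1 + u ^ 2)⁻¹) hp.ne'
  simp only [Function.comp_apply, id]
  rw [mul_zero, smul_eq_mul] at h3
  rw [← h3]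
  refine intervalIntegral.integral_congr fun ξ _ => ?_
  rw [mul_comm, mul_pow]
  congr 2
  field_simp

lemma abs_integral_cos_inv_one_add_sq_mul_sq_le (p : ℝ) {x : ℝ} (hx : x ≠ 0) {R : ℝ}
    (hR : 0 ≤ R) :
    |∫ ξ in (0 : ℝ)..R, (1 + p ^ 2 * ξ ^ 2)⁻¹ * cos (x * ξ)| ≤ 1 / |x| := by
  set u : ℝ → ℝ := fun ξ => (1 + p ^ 2 * ξ ^ 2)⁻¹
  set u' : ℝ → ℝ := fun ξ => -(p ^ 2 * (2 * ξ)) / (1 + p ^ 2 * ξ ^ 2) ^ 2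
  have hu : ∀ ξ, HasDerivAt u (u' ξ) ξ := fun ξ => by
    have h := (((hasDerivAt_pow 2 ξ).const_mul (p ^ 2)).const_add 1).fun_inv
      (x := ξ) (by positivity)
    simpa using h
  have hv : ∀ ξ, HasDerivAt (fun ξ => sin (x * ξ) / x) (cos (x * ξ)) ξ := fun ξ => by
    have h := (((hasDerivAt_id ξ).const_mul x).sin).div_const x
    simpa [hx] using h
  have hu'c : Continuous u' := by
    refine Continuous.div (by fun_prop) (by fun_prop) fun ξ => by positivity
  have hu'i : ∀ a b, IntervalIntegrable u' volume a b := fun a b => hu'c.intervalIntegrable a b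
  have hparts := intervalIntegral.integral_mul_deriv_eq_deriv_mul (a := 0) (b := R)
    (fun ξ _ => hu ξ) (fun ξ _ => hv ξ) (hu'i 0 R)
    ((by fun_prop : Continuous fun ξ => cos (x * ξ)).intervalIntegrable 0 R)
  have hsin : ∀ ξ, |sin (x * ξ) / x| ≤ 1 / |x| := fun ξ => by
    rw [abs_div]; exact div_le_div_of_nonneg_right (abs_sin_le_one _) (abs_nonneg _)
  have hu0 : ∀ ξ, 0 ≤ u ξ := fun ξ => by positivity
  have hI : |∫ ξ in (0 : ℝ)..R, u' ξ * (sin (x * ξ) / x)| ≤ (u 0 - u R) * (1 / |x|) := by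
    rw [← norm_eq_abs]
    refine (intervalIntegral.norm_integral_le_of_norm_le hR
      (ae_of_all _ fun ξ hξ => ?_) ((hu'i 0 R).neg.mul_const (1 / |x|))).trans_eq ?_
    · rw [norm_mul, norm_of_nonpos]
      · exact mul_le_mul_of_nonneg_left (hsin ξ)
          (neg_nonneg.2 (div_nonpos_of_nonpos_of_nonneg (by
            have := hξ.1; have : 0 ≤ p ^ 2 * (2 * ξ) := by positivity
            linarith) (by positivity)))
      · exact div_nonpos_of_nonpos_of_nonneg (by
            have := hξ.1; have : 0 ≤ p ^ 2 * (2 * ξ) := by positivity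
            linarith) (by positivity)
    · rw [intervalIntegral.integral_mul_const]
      simp only [Pi.neg_apply]
      rw [intervalIntegral.integral_neg,
        intervalIntegral.integral_eq_sub_of_hasDerivAt (fun ξ _ => hu ξ) (hu'i 0 R)]
      ring
  rw [hparts]
  have h0 : u 0 = 1 := by simp [u]
  calc _ ≤ |u R * (sin (x * R) / x)| + |∫ ξ in (0 : ℝ)..R, u' ξ * (sin (x * ξ) / x)| := by
        simpa using abs_sub (u R * (sin (x * R) / x)) (∫ ξ in (0 : ℝ)..R, u' ξ * (sin (x * ξ) / x))
    _ ≤ u R * (1 / |x|) + (u 0 - u R) * (1 / |x|) := by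
        refine add_le_add ?_ hI
        rw [abs_mul, abs_of_nonneg (hu0 R)]
        exact mul_le_mul_of_nonneg_left (hsin R) (hu0 R)
    _ = 1 / |x| := by rw [h0]; ring

/-- The probability density with Fourier transform `1 / (1 + p² ξ²)`. -/
noncomputable def laplaceDensity (p x : ℝ) : ℝ := (2 * p)⁻¹ * rexp (-(|x| / p))

lemma laplaceDensity_nonneg {p : ℝ} (hp : 0 ≤ p) (x : ℝ) : 0 ≤ laplaceDensity p x := by
  unfold laplaceDensity; positivity

lemma laplaceDensity_le {p x : ℝ} (hp : 0 < p) (hx : x ≠ 0) :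
    laplaceDensity p x ≤ (2 * |x|)⁻¹ := by
  have hx' := abs_pos.2 hx
  have h : |x| / p ≤ rexp (|x| / p) := by linarith [add_one_le_exp (|x| / p)]
  rw [laplaceDensity, exp_neg, ← mul_inv]
  refine inv_anti₀ (by positivity) ?_
  calc 2 * |x| = 2 * p * (|x| / p) := by field_simp
    _ ≤ _ := by gcongr

lemma measurable_uncurry_laplaceDensity : Measurable (Function.uncurry laplaceDensity) := by
  unfold laplaceDensity Function.uncurry
  fun_prop

lemma integrable_laplaceDensity {p : ℝ} (hp : 0 < p) : Integrable (laplaceDensity p) := by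
  have h := (integrable_exp_neg_abs.comp_mul_left' (R := p⁻¹) (by positivity)).const_mul (2 * p)⁻¹
  refine h.congr (ae_of_all _ fun x => ?_)
  simp only [laplaceDensity, abs_mul, abs_of_pos (inv_pos.2 hp)]
  rw [mul_comm p⁻¹, div_eq_mul_inv]

lemma integral_laplaceDensity {p : ℝ} (hp : 0 < p) : ∫ x, laplaceDensity p x = 1 := by
  have h := integral_comp_abs (f := fun x => (2 * p)⁻¹ * rexp (-p⁻¹ * x))
  simp only [integral_const_mul] at h
  rw [integral_exp_mul_Ioi (by simpa using hp), ← integral_const_mul] at h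
  simp only [laplaceDensity, div_eq_mul_inv, ← neg_mul] at h ⊢
  simp only [neg_mul, mul_comm p⁻¹] at h ⊢
  rw [h]
  simp
  field_simp

lemma integrable_laplaceDensity_param (τ : Measure I) [IsFiniteMeasure τ]
    (hτ : ∀ᵐ p : I ∂τ, (0 : ℝ) < p) {x : ℝ} (hx : x ≠ 0) :
    Integrable (fun p : I => laplaceDensity p x) τ := by
  refine (integrable_const (2 * |x|)⁻¹).mono' ?_ ?_
  · exact ((measurable_uncurry_laplaceDensity.comp
      (measurable_subtype_coe.prodMk measurable_const))).aestronglyMeasurable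
  · filter_upwards [hτ] with p hp
    rw [norm_of_nonneg (laplaceDensity_nonneg hp.le x)]
    exact laplaceDensity_le hp hx

lemma whithamKernel_eq_integral (τ : Measure I) [IsProbabilityMeasure τ]
    (hτ : ∀ᵐ p : I ∂τ, (0 : ℝ) < p)
    (hm : ∀ ξ, whithamSymbol ξ = ∫ p : I, (1 + (p : ℝ) ^ 2 * ξ ^ 2)⁻¹ ∂τ) {x : ℝ} (hx : x ≠ 0) :
    whithamKernel x = ∫ p : I, laplaceDensity p x ∂τ := by
  have hc : Continuous (Function.uncurry fun (p : I) (ξ : ℝ) =>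
      (1 + (p : ℝ) ^ 2 * ξ ^ 2)⁻¹ * cos (x * ξ)) := by
    refine Continuous.mul (Continuous.inv₀ (by fun_prop) fun q => ?_) (by fun_prop)
    positivity
  rw [whithamKernel, if_neg hx]
  apply Filter.Tendsto.limUnder_eq
  have hswap : ∀ R : ℝ, ∫ ξ in (0 : ℝ)..R, whithamSymbol ξ * cos (x * ξ) =
      ∫ p : I, (∫ ξ in (0 : ℝ)..R, (1 + (p : ℝ) ^ 2 * ξ ^ 2)⁻¹ * cos (x * ξ)) ∂τ := fun R => by
    rw [← intervalIntegral_integral_swap]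
    · refine intervalIntegral.integral_congr fun ξ _ => ?_
      simp only [hm, integral_mul_const]
    · have : IsFiniteMeasure ((volume.restrict (Set.uIoc 0 R)).prod τ) := by
        have : IsFiniteMeasure (volume.restrict (Set.uIoc 0 R)) :=
          ⟨by simp [Set.uIoc]⟩
        infer_instance
      refine (integrable_const (1 : ℝ)).mono' ?_ (ae_of_all _ fun q => ?_)
      · exact (hc.comp continuous_swap).aestronglyMeasurable
      · rw [Function.uncurry, norm_mul, norm_of_nonneg (r := (_)⁻¹) (by positivity)]
        exact mul_le_one₀
          (inv_le_one_of_one_le₀ (by nlinarith [mul_nonneg (sq_nonneg (q.2 : ℝ)) (sq_nonneg q.1)]))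
          (norm_nonneg _) (abs_cos_le_one _)
  simp only [hswap]
  have hlim := tendsto_integral_filter_of_dominated_convergence (μ := τ) (l := atTop)
    (F := fun (R : ℝ) (p : I) => ∫ ξ in (0 : ℝ)..R, (1 + (p : ℝ) ^ 2 * ξ ^ 2)⁻¹ * cos (x * ξ))
    (f := fun p : I => π * laplaceDensity p x) (fun _ => 1 / |x|)
    (Eventually.of_forall fun R =>
      (intervalIntegral.continuous_parametric_intervalIntegral_of_continuous' hc 0 R
        ).aestronglyMeasurable)
    ((eventually_ge_atTop 0).mono fun R hR => ae_of_all _ fun p =>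
      abs_integral_cos_inv_one_add_sq_mul_sq_le p hx hR)
    (integrable_const _)
    (hτ.mono fun p hp => tendsto_integral_cos_inv_one_add_sq_mul_sq hp x)
  have h := hlim.const_mul (1 / π)
  rwa [integral_const_mul, ← mul_assoc, one_div_mul_cancel pi_ne_zero, one_mul] at h

/-- The Whitham kernel is a mixture of Laplace densities. -/
theorem exists_whithamKernel_eq_integral : ∃ τ : Measure I, IsProbabilityMeasure τ ∧
    (∀ᵐ p : I ∂τ, (0 : ℝ) < p) ∧ ∀ x ≠ 0, whithamKernel x = ∫ p : I, laplaceDensity p x ∂τ := by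
  obtain ⟨τ, h1, h2, h3⟩ := exists_probabilityMeasure_whithamSymbol
  exact ⟨τ, h1, h2, fun x hx => whithamKernel_eq_integral τ h2 h3 hx⟩

lemma whithamKernel_zero : whithamKernel 0 = 0 := if_pos rfl

lemma whithamKernel_neg (x : ℝ) : whithamKernel (-x) = whithamKernel x := by
  simp only [whithamKernel, neg_eq_zero, neg_mul, cos_neg]

lemma whithamKernel_abs (x : ℝ) : whithamKernel |x| = whithamKernel x := by
  rcases abs_choice x with h | h <;> simp [h, whithamKernel_neg]

lemma whithamKernel_nonneg (x : ℝ) : 0 ≤ whithamKernel x := by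
  rcases eq_or_ne x 0 with rfl | hx
  · rw [whithamKernel_zero]
  obtain ⟨τ, _, hτ, h⟩ := exists_whithamKernel_eq_integral
  rw [h x hx]
  exact integral_nonneg_of_ae (hτ.mono fun p hp => laplaceDensity_nonneg hp.le x)

lemma whithamKernel_le {x : ℝ} (hx : x ≠ 0) : whithamKernel x ≤ (2 * |x|)⁻¹ := by
  obtain ⟨τ, _, hτ, h⟩ := exists_whithamKernel_eq_integral
  rw [h x hx]
  refine (integral_mono_ae (integrable_laplaceDensity_param τ hτ hx) (integrable_const _)
    (hτ.mono fun p hp => laplaceDensity_le hp hx)).trans_eq ?_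
  simp

lemma integral_pos_of_ae_pos {α : Type*} [MeasurableSpace α] {μ : Measure α} [NeZero μ]
    {f : α → ℝ} (hf : Integrable f μ) (hpos : ∀ᵐ a ∂μ, 0 < f a) : 0 < ∫ a, f a ∂μ := by
  rw [integral_pos_iff_support_of_nonneg_ae (hpos.mono fun a h => h.le) hf,
    measure_congr (s := Function.support f) (t := Set.univ)
      (eventuallyEq_univ.2 (hpos.mono fun a h => h.ne'))]
  exact Measure.measure_univ_pos.2 (NeZero.ne μ)

lemma whithamKernel_strictAntiOn : StrictAntiOn whithamKernel (Set.Ioi 0) := by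
  intro x hx y hy hxy
  rw [Set.mem_Ioi] at hx hy
  obtain ⟨τ, _, hτ, h⟩ := exists_whithamKernel_eq_integral
  have hi := fun {x : ℝ} (hx : x ≠ 0) => integrable_laplaceDensity_param τ hτ hx
  rw [h x hx.ne', h y hy.ne', ← sub_pos, ← integral_sub (hi hx.ne') (hi hy.ne')]
  refine integral_pos_of_ae_pos ((hi hx.ne').sub (hi hy.ne')) (hτ.mono fun p hp => ?_)
  rw [laplaceDensity, laplaceDensity, abs_of_pos hx, abs_of_pos hy, sub_pos]
  gcongr

/-- A discrete form of convexity of the Whitham kernel on the half-line. -/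
lemma whithamKernel_sub_le_sub {a b l : ℝ} (ha : 0 < a) (hab : a ≤ b) (hl : 0 ≤ l) :
    whithamKernel b - whithamKernel (b + l) ≤ whithamKernel a - whithamKernel (a + l) := by
  obtain ⟨τ, _, hτ, h⟩ := exists_whithamKernel_eq_integral
  have hi := fun {x : ℝ} (hx : 0 < x) => integrable_laplaceDensity_param τ hτ hx.ne'
  have hb : 0 < b := by linarith
  have hal : 0 < a + l := by linarith
  have hbl : 0 < b + l := by linarith
  rw [h a ha.ne', h b hb.ne', h _ hal.ne', h _ hbl.ne', ← integral_sub (hi hb) (hi hbl),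
    ← integral_sub (hi ha) (hi hal)]
  refine integral_mono_ae ((hi hb).sub (hi hbl)) ((hi ha).sub (hi hal)) (hτ.mono fun p hp => ?_)
  have key : ∀ x, 0 < x → laplaceDensity p x - laplaceDensity p (x + l) =
      (2 * (p : ℝ))⁻¹ * (rexp (-(x / p)) * (1 - rexp (-(l / p)))) := fun x hx => by
    rw [laplaceDensity, laplaceDensity, abs_of_pos hx, abs_of_pos (by linarith : 0 < x + l),
      add_div, neg_add, exp_add]
    ring
  simp only [key a ha, key b hb]
  have h1 : 0 ≤ 1 - rexp (-(l / p)) := by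
    rw [sub_nonneg, exp_le_one_iff, neg_nonpos]; positivity
  gcongr

lemma integrable_whithamKernel_and_integral_eq_one :
    Integrable whithamKernel ∧ ∫ x, whithamKernel x = 1 := by
  obtain ⟨τ, _, hτ, h⟩ := exists_whithamKernel_eq_integral
  have hae : whithamKernel =ᵐ[volume] fun x => ∫ p : I, laplaceDensity p x ∂τ := by
    filter_upwards [compl_mem_ae_iff.2 (measure_singleton (0 : ℝ))] with x hx using h x hx
  have hmeas : Measurable fun q : I × ℝ => laplaceDensity q.1 q.2 :=
    measurable_uncurry_laplaceDensity.comp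
      ((measurable_subtype_coe.comp measurable_fst).prodMk measurable_snd)
  have hint : Integrable (fun q : I × ℝ => laplaceDensity q.1 q.2) (τ.prod volume) := by
    rw [integrable_prod_iff hmeas.aestronglyMeasurable]
    refine ⟨hτ.mono fun p hp => integrable_laplaceDensity hp, (integrable_const (1 : ℝ)).congr ?_⟩
    filter_upwards [hτ] with p hp
    simp only [norm_of_nonneg (laplaceDensity_nonneg hp.le _), integral_laplaceDensity hp]
  refine ⟨hint.swap.integral_prod_left.congr hae.symm, ?_⟩
  rw [integral_congr_ae hae, ← integral_integral_swap hint,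
    integral_congr_ae (g := fun _ => (1 : ℝ)) (hτ.mono fun p hp => integral_laplaceDensity hp)]
  simp

lemma integrable_whithamKernel : Integrable whithamKernel :=
  integrable_whithamKernel_and_integral_eq_one.1

lemma integral_whithamKernel : ∫ x, whithamKernel x = 1 :=
  integrable_whithamKernel_and_integral_eq_one.2

lemma integrable_whithamKernel_sub_mul {f : ℝ → ℝ} (hf : Continuous f) {C : ℝ}
    (hC : ∀ y, |f y| ≤ C) (x : ℝ) : Integrable fun y => whithamKernel (x - y) * f y :=
  (integrable_whithamKernel.comp_sub_left x).mul_bdd hf.aestronglyMeasurable (ae_of_all _ hC)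

lemma Lop_sub {f g : ℝ → ℝ} (hf : Continuous f) (hg : Continuous g) {C C' : ℝ}
    (hC : ∀ y, |f y| ≤ C) (hC' : ∀ y, |g y| ≤ C') (x : ℝ) :
    Lop whithamKernel (fun y => f y - g y) x =
      Lop whithamKernel f x - Lop whithamKernel g x := by
  simp only [Lop, mul_sub]
  exact integral_sub (integrable_whithamKernel_sub_mul hf hC x)
    (integrable_whithamKernel_sub_mul hg hC' x)

lemma Lop_comp_add_right (K f : ℝ → ℝ) (h x : ℝ) :
    Lop K (fun y => f (y + h)) x = Lop K f (x + h) := by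
  rw [Lop, Lop, ← integral_add_right_eq_self (fun y => K (x + h - y) * f y) h]
  simp only [add_sub_add_right_eq_sub]

lemma Lop_whithamKernel_comp_sub_left (f : ℝ → ℝ) (c x : ℝ) :
    Lop whithamKernel (fun y => f (c - y)) x = Lop whithamKernel f (c - x) := by
  rw [Lop, Lop, ← integral_sub_left_eq_self (fun y => whithamKernel (c - x - y) * f y) volume c]
  refine integral_congr_ae (ae_of_all _ fun y => ?_)
  simp only
  rw [← whithamKernel_neg]
  ring_nf

lemma Lop_whithamKernel_const (c x : ℝ) : Lop whithamKernel (fun _ => c) x = c := by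
  rw [Lop, integral_mul_const, integral_sub_left_eq_self whithamKernel volume x,
    integral_whithamKernel, one_mul]

/-- The kernel of `L` on odd functions, folded to the half-line. -/
noncomputable def oddWhithamKernel (x y : ℝ) : ℝ := whithamKernel (x - y) - whithamKernel (x + y)

lemma integrable_oddWhithamKernel_mul {f : ℝ → ℝ} (hf : Continuous f) {C : ℝ}
    (hC : ∀ y, |f y| ≤ C) (x : ℝ) : Integrable fun y => oddWhithamKernel x y * f y :=
  ((integrable_whithamKernel.comp_sub_left x).sub
    (integrable_whithamKernel.comp_add_left x)).mul_bdd hf.aestronglyMeasurable (ae_of_all _ hC)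

lemma Lop_whithamKernel_of_odd {f : ℝ → ℝ} (hf : Continuous f) {C : ℝ} (hC : ∀ y, |f y| ≤ C)
    (hodd : ∀ y, f (-y) = -f y) (x : ℝ) :
    Lop whithamKernel f x = ∫ y in Set.Ioi 0, oddWhithamKernel x y * f y := by
  have hi := integrable_whithamKernel_sub_mul hf hC x
  have hi' : Integrable fun y => whithamKernel (x + y) * f y :=
    (integrable_whithamKernel.comp_add_left x).mul_bdd hf.aestronglyMeasurable (ae_of_all _ hC)
  rw [Lop, ← intervalIntegral.integral_Iic_add_Ioi (b := 0) hi.integrableOn hi.integrableOn]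
  have h := integral_comp_neg_Ioi 0 fun y => whithamKernel (x - y) * f y
  rw [neg_zero] at h
  rw [← h]
  simp only [oddWhithamKernel, sub_mul]
  rw [integral_sub hi.integrableOn hi'.integrableOn]
  simp only [sub_neg_eq_add, hodd, mul_neg, integral_neg]
  ring

lemma whithamKernel_lt_of_abs_lt {a b : ℝ} (ha : a ≠ 0) (hab : |a| < |b|) :
    whithamKernel b < whithamKernel a := by
  rw [← whithamKernel_abs a, ← whithamKernel_abs b]
  exact whithamKernel_strictAntiOn (abs_pos.2 ha) ((abs_pos.2 ha).trans hab) hab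

lemma oddWhithamKernel_pos {x y : ℝ} (hx : 0 < x) (hy : 0 < y) (hxy : x ≠ y) :
    0 < oddWhithamKernel x y := by
  refine sub_pos.2 (whithamKernel_lt_of_abs_lt (sub_ne_zero.2 hxy) ?_)
  rw [abs_of_pos (add_pos hx hy), abs_lt]
  constructor <;> linarith

/-- Strict positivity of `L` on odd functions that are nonnegative on the half-line. -/
lemma eq_zero_of_Lop_whithamKernel_eq_zero {f : ℝ → ℝ} (hf : Continuous f) {C : ℝ}
    (hC : ∀ y, |f y| ≤ C) (hodd : ∀ y, f (-y) = -f y) (hpos : ∀ y, 0 < y → 0 ≤ f y) {x : ℝ}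
    (hx : 0 < x) (h0 : Lop whithamKernel f x = 0) (y : ℝ) : f y = 0 := by
  rw [Lop_whithamKernel_of_odd hf hC hodd, setIntegral_eq_zero_iff_of_nonneg_ae _
    (integrable_oddWhithamKernel_mul hf hC x).integrableOn] at h0
  · have hae : f =ᵐ[volume.restrict (Set.Ioi 0)] fun _ => 0 := by
      filter_upwards [h0, ae_restrict_of_ae (compl_mem_ae_iff.2 (measure_singleton x)),
        ae_restrict_mem measurableSet_Ioi] with z hz hzx hz0
      exact (mul_eq_zero.1 hz).resolve_left
        (oddWhithamKernel_pos hx hz0 fun h => hzx h.symm).ne'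
    have hon : Set.EqOn f (fun _ => 0) (Set.Ioi 0) :=
      Measure.eqOn_open_of_ae_eq hae isOpen_Ioi hf.continuousOn continuousOn_const
    rcases lt_trichotomy y 0 with hy | rfl | hy
    · have := hodd (-y)
      rw [neg_neg] at this
      rw [this, hon (neg_pos.2 hy), neg_zero]
    · have := hodd 0
      rw [neg_zero] at this
      linarith
    · exact hon hy
  · filter_upwards [ae_restrict_of_ae (compl_mem_ae_iff.2 (measure_singleton x)),
      ae_restrict_mem measurableSet_Ioi] with z hzx hz0
    exact mul_nonneg (oddWhithamKernel_pos hx hz0 fun h => hzx h.symm).le (hpos z hz0)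

/-- The truncated periodization of `oddWhithamKernel x`, folded to half a period. -/
noncomputable def periodizedOddKernel (P x : ℝ) (M : ℕ) (y : ℝ) : ℝ :=
  oddWhithamKernel x y + ∑ n ∈ Finset.range M,
    (oddWhithamKernel x ((n + 1) * P + y) - oddWhithamKernel x ((n + 1) * P - y))

lemma integrable_oddWhithamKernel (x : ℝ) : Integrable (oddWhithamKernel x) :=
  (integrable_whithamKernel.comp_sub_left x).sub (integrable_whithamKernel.comp_add_left x)

lemma integrable_periodizedOddKernel_mul {f : ℝ → ℝ} (hf : Continuous f) {C : ℝ}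
    (hC : ∀ y, |f y| ≤ C) (P x : ℝ) (M : ℕ) :
    Integrable fun y => periodizedOddKernel P x M y * f y :=
  ((integrable_oddWhithamKernel x).add (integrable_finsetSum _ fun _ _ =>
    ((integrable_oddWhithamKernel x).comp_add_left _).sub
      ((integrable_oddWhithamKernel x).comp_sub_left _))).mul_bdd hf.aestronglyMeasurable
        (ae_of_all _ hC)

lemma integral_oddWhithamKernel_mul_eq_periodized {f : ℝ → ℝ} (hf : Continuous f) {C : ℝ}
    (hC : ∀ y, |f y| ≤ C) (hodd : ∀ y, f (-y) = -f y) {P : ℝ} (hper : Function.Periodic f P)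
    (x : ℝ) (M : ℕ) :
    ∫ y in (0 : ℝ)..(M * P + P / 2), oddWhithamKernel x y * f y =
      ∫ y in (0 : ℝ)..(P / 2), periodizedOddKernel P x M y * f y := by
  have hi := integrable_oddWhithamKernel_mul hf hC x
  induction M with
  | zero => simp [periodizedOddKernel]
  | succ M ih =>
    have hadd : Integrable fun y => oddWhithamKernel x ((M + 1) * P + y) * f y :=
      ((integrable_oddWhithamKernel x).comp_add_left _).mul_bdd hf.aestronglyMeasurable
        (ae_of_all _ hC)
    have hsub : Integrable fun y => oddWhithamKernel x ((M + 1) * P - y) * f y :=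
      ((integrable_oddWhithamKernel x).comp_sub_left _).mul_bdd hf.aestronglyMeasurable
        (ae_of_all _ hC)
    have h1 : ∫ y in (0 : ℝ)..(P / 2), periodizedOddKernel P x (M + 1) y * f y =
        (∫ y in (0 : ℝ)..(P / 2), periodizedOddKernel P x M y * f y) +
        ((∫ y in (0 : ℝ)..(P / 2), oddWhithamKernel x ((M + 1) * P + y) * f y) -
          ∫ y in (0 : ℝ)..(P / 2), oddWhithamKernel x ((M + 1) * P - y) * f y) := by
      rw [← intervalIntegral.integral_sub hadd.intervalIntegrable hsub.intervalIntegrable,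
        ← intervalIntegral.integral_add
          (integrable_periodizedOddKernel_mul hf hC P x M).intervalIntegrable
          (hadd.intervalIntegrable.sub hsub.intervalIntegrable)]
      refine intervalIntegral.integral_congr fun y _ => ?_
      simp only [periodizedOddKernel, Finset.sum_range_succ]
      ring
    have hp : ∀ y, f ((M + 1) * P + y) = f y := fun y => by
      have := hper.nat_mul (M + 1) y
      rwa [add_comm, Nat.cast_add_one] at this
    have hn : ∀ y, f ((M + 1) * P - y) = -f y := fun y => by
      rw [sub_eq_add_neg, hp, hodd]
    have h2 := intervalIntegral.integral_comp_add_left (a := 0) (b := P / 2)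
      (fun y => oddWhithamKernel x y * f y) ((M + 1) * P)
    have h3 := intervalIntegral.integral_comp_sub_left (a := 0) (b := P / 2)
      (fun y => oddWhithamKernel x y * f y) ((M + 1) * P)
    simp only [hp, hn, mul_neg, intervalIntegral.integral_neg, add_zero, sub_zero] at h2 h3
    rw [h1, ← ih, h2, sub_eq_add_neg, h3,
      add_comm (intervalIntegral _ _ _ _) (intervalIntegral _ ((M + 1) * P - P / 2) _ _),
      intervalIntegral.integral_add_adjacent_intervals hi.intervalIntegrable hi.intervalIntegrable,
      show (M + 1) * P - P / 2 = M * P + P / 2 by ring,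
      intervalIntegral.integral_add_adjacent_intervals hi.intervalIntegrable hi.intervalIntegrable]
    push_cast
    rfl

lemma le_periodizedOddKernel {P x y : ℝ} (hx : 0 < x) (hxP : x < P / 2) (hy : 0 < y)
    (hyP : y < P / 2) (hxy : x ≠ y) (M : ℕ) :
    whithamKernel |x - y| - whithamKernel (x + y) -
      (whithamKernel (P - (x + y)) - whithamKernel (P - |x - y|)) ≤
      periodizedOddKernel P x (M + 1) y := by
  set d := |x - y| with hd
  set s := x + y with hs
  have hd0 : 0 < d := abs_pos.2 (sub_ne_zero.2 hxy)
  have hds : d ≤ s := by rw [hd, hs, abs_le]; constructor <;> linarith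
  have hdsP : d + s < P := by
    rcases abs_cases (x - y) with ⟨h, -⟩ | ⟨h, -⟩ <;> rw [hd, hs, h] <;> linarith
  have hpair : ∀ n : ℕ, oddWhithamKernel x ((n + 1) * P + y) - oddWhithamKernel x ((n + 1) * P - y)
      = whithamKernel ((n + 1) * P + d) + whithamKernel ((n + 1) * P - d) -
        whithamKernel ((n + 1) * P + s) - whithamKernel ((n + 1) * P - s) := fun n => by
    rw [oddWhithamKernel, oddWhithamKernel, ← whithamKernel_neg (x - _),
      ← whithamKernel_neg (x - _),
      hs, hd]
    rcases abs_cases (x - y) with ⟨h, -⟩ | ⟨h, -⟩ <;> rw [h] <;> ring_nf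
  have h0 : oddWhithamKernel x y = whithamKernel d - whithamKernel s := by
    rw [oddWhithamKernel, hd, whithamKernel_abs]
  suffices h : whithamKernel d - whithamKernel s - (whithamKernel (P - s) - whithamKernel (P - d)) +
      (whithamKernel ((M + 1) * P + d) - whithamKernel ((M + 1) * P + s)) ≤
      periodizedOddKernel P x (M + 1) y by
    have hM : (0 : ℝ) ≤ (M + 1) * P := by
      have : 0 < P := by linarith
      positivity
    have := whithamKernel_strictAntiOn.antitoneOn
      (show (M + 1) * P + d ∈ Set.Ioi 0 from Set.mem_Ioi.2 (by linarith))
      (show (M + 1) * P + s ∈ Set.Ioi 0 from Set.mem_Ioi.2 (by linarith)) (by linarith)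
    linarith
  induction M with
  | zero =>
    have := hpair 0
    simp only [CharP.cast_eq_zero, zero_add, one_mul] at this
    simp only [periodizedOddKernel, zero_add, Finset.sum_range_one, CharP.cast_eq_zero, one_mul,
      this, h0]
    linarith
  | succ M ih =>
    have hM : (0 : ℝ) ≤ (M + 1) * P := by
      have : 0 < P := by linarith
      positivity
    have hc := whithamKernel_sub_le_sub (a := (M + 1) * P + d) (b := (M + 2) * P - s) (l := s - d)
      (by linarith) (by linarith) (by linarith)
    rw [show (M + 2 : ℝ) * P - s + (s - d) = (M + 2) * P - d by ring,
      show (M + 1 : ℝ) * P + d + (s - d) = (M + 1) * P + s by ring] at hc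
    have hp := hpair (M + 1)
    push_cast at hp ⊢
    rw [add_assoc (M : ℝ), one_add_one_eq_two] at hp ⊢
    have hsucc : periodizedOddKernel P x (M + 1 + 1) y = periodizedOddKernel P x (M + 1) y +
        (oddWhithamKernel x ((M + 2) * P + y) - oddWhithamKernel x ((M + 2) * P - y)) := by
      rw [periodizedOddKernel, Finset.sum_range_succ, ← add_assoc, ← periodizedOddKernel]
      push_cast
      rw [add_assoc (M : ℝ), one_add_one_eq_two]
    rw [hsucc, hp]
    linarith

/-- A lower bound for `L` on odd periodic functions, uniform in large periods. -/
lemma mul_integral_le_Lop_whithamKernel {f : ℝ → ℝ} (hf : Continuous f) {C : ℝ}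
    (hC : ∀ y, |f y| ≤ C) (hodd : ∀ y, f (-y) = -f y) {P : ℝ} (hper : Function.Periodic f P)
    (hP : 6 ≤ P) (hpos : ∀ y ∈ Set.Icc 0 (P / 2), 0 ≤ f y) {x : ℝ} (hx : x ∈ Set.Icc (1 : ℝ) 2) :
    (whithamKernel 1 - whithamKernel 2 - whithamKernel (P - 4)) * ∫ y in (1 : ℝ)..2, f y ≤
      Lop whithamKernel f x := by
  set δ := whithamKernel 1 - whithamKernel 2 - whithamKernel (P - 4)
  obtain ⟨hx1, hx2⟩ := hx
  have hanti := whithamKernel_strictAntiOn.antitoneOn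
  have hM : ∀ M : ℕ, δ * ∫ y in (1 : ℝ)..2, f y ≤
      ∫ y in (0 : ℝ)..(((M + 1 : ℕ) : ℝ) * P + P / 2), oddWhithamKernel x y * f y := fun M => by
    rw [integral_oddWhithamKernel_mul_eq_periodized hf hC hodd hper]
    have hi := integrable_periodizedOddKernel_mul hf hC P x (M + 1)
    have hlow : ∀ y ∈ Set.Ioo 0 (P / 2), x ≠ y → 0 ≤ periodizedOddKernel P x (M + 1) y := by
      intro y hy hxy
      refine le_trans ?_ (le_periodizedOddKernel (by linarith) (by linarith) hy.1 hy.2 hxy M)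
      have hd0 : 0 < |x - y| := abs_pos.2 (sub_ne_zero.2 hxy)
      have hy1 := hy.1
      have hy2 := hy.2
      have h1 : |x - y| ≤ x + y := by rw [abs_le]; constructor <;> linarith
      have h2 : |x - y| + (x + y) < P := by
        rcases abs_cases (x - y) with ⟨h, -⟩ | ⟨h, -⟩ <;> rw [h] <;> linarith
      have hc := whithamKernel_sub_le_sub (a := |x - y|) (b := P - (x + y)) (l := x + y - |x - y|)
        hd0 (by linarith) (by linarith)
      rw [show P - (x + y) + (x + y - |x - y|) = P - |x - y| by ring,
        show |x - y| + (x + y - |x - y|) = x + y by ring] at hc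
      linarith
    have hlow' : ∀ y ∈ Set.Icc (1 : ℝ) 2, x ≠ y → δ ≤ periodizedOddKernel P x (M + 1) y := by
      intro y hy hxy
      obtain ⟨hy1, hy2⟩ := hy
      refine le_trans ?_ (le_periodizedOddKernel (by linarith) (by linarith) (by linarith)
        (by linarith) hxy M)
      have hd0 : 0 < |x - y| := abs_pos.2 (sub_ne_zero.2 hxy)
      have h1 : |x - y| ≤ 1 := by rw [abs_le]; constructor <;> linarith
      have k1 := hanti hd0 (Set.mem_Ioi.2 one_pos) h1
      have k2 := hanti (Set.mem_Ioi.2 two_pos) (Set.mem_Ioi.2 (by linarith : 0 < x + y))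
        (by linarith)
      have k3 := hanti (Set.mem_Ioi.2 (by linarith : 0 < P - 4))
        (Set.mem_Ioi.2 (by linarith : 0 < P - (x + y))) (by linarith)
      have k4 := whithamKernel_nonneg (P - |x - y|)
      simp only [δ]
      linarith
    rw [← intervalIntegral.integral_const_mul]
    calc ∫ y in (1 : ℝ)..2, δ * f y
        ≤ ∫ y in (1 : ℝ)..2, periodizedOddKernel P x (M + 1) y * f y := by
          refine intervalIntegral.integral_mono_ae_restrict one_le_two
            ((hf.const_smul δ).intervalIntegrable 1 2) hi.intervalIntegrable ?_
          filter_upwards [ae_restrict_of_ae (compl_mem_ae_iff.2 (measure_singleton x)),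
            ae_restrict_mem measurableSet_Icc] with y hyx hy
          exact mul_le_mul_of_nonneg_right (hlow' y hy fun h => hyx h.symm)
            (hpos y ⟨by linarith [hy.1], by linarith [hy.2]⟩)
      _ ≤ _ := by
          refine intervalIntegral.integral_mono_interval zero_le_one one_le_two (by linarith) ?_
            hi.intervalIntegrable
          filter_upwards [ae_restrict_of_ae (compl_mem_ae_iff.2 (measure_singleton x)),
            ae_restrict_of_ae (compl_mem_ae_iff.2 (measure_singleton (P / 2))),
            ae_restrict_mem measurableSet_Ioc] with y hyx hyP hy
          have hyP' : y < P / 2 := lt_of_le_of_ne hy.2 hyP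
          exact mul_nonneg (hlow y ⟨hy.1, hyP'⟩ fun h => hyx h.symm) (hpos y ⟨hy.1.le, hy.2⟩)
  rw [Lop_whithamKernel_of_odd hf hC hodd]
  have htop : Tendsto (fun M : ℕ => ((M + 1 : ℕ) : ℝ) * P + P / 2) atTop atTop :=
    tendsto_atTop_add_const_right _ _ (Tendsto.atTop_mul_const (by linarith)
      (tendsto_natCast_atTop_atTop.comp (tendsto_add_atTop_nat 1)))
  exact ge_of_tendsto' (intervalIntegral_tendsto_integral_Ioi 0
    (integrable_oddWhithamKernel_mul hf hC x).integrableOn htop) hM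

/-- Translation is continuous in `L¹`. -/
lemma tendsto_integral_norm_comp_add_sub {f : ℝ → ℝ} (hf : Integrable f) :
    Tendsto (fun h : ℝ => ∫ z, |f (h + z) - f z|) (𝓝 0) (𝓝 0) := by
  have hf1 : MemLp f 1 := memLp_one_iff_integrable.2 hf
  have : Fact ((1 : ENNReal) ≠ ⊤) := ⟨ENNReal.one_ne_top⟩
  have hc : Continuous fun h : ℝ => DomAddAct.mk h +ᵥ hf1.toLp f :=
    (DomAddAct.continuous_mk.vadd continuous_const)
  have h0 := (tendsto_iff_norm_sub_tendsto_zero.1 (hc.tendsto 0))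
  have hzero : DomAddAct.mk (0 : ℝ) +ᵥ hf1.toLp f = hf1.toLp f := by
    rw [DomAddAct.mk_zero, zero_vadd]
  rw [hzero] at h0
  refine h0.congr fun h => ?_
  rw [DomAddAct.mk_vadd_toLp, ← MemLp.toLp_sub, L1.norm_eq_integral_norm]
  exact integral_congr_ae ((MemLp.coeFn_toLp ((hf1.comp_measurePreserving
    (measurePreserving_vadd h volume)).sub hf1)).mono fun z hz => congrArg norm hz)

/-- The modulus of continuity of `L f` for `|f| ≤ 1`. -/
noncomputable def whithamModulus (h : ℝ) : ℝ := ∫ z, |whithamKernel (h + z) - whithamKernel z|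

lemma tendsto_sqrt_whithamModulus :
    Tendsto (fun h => √(whithamModulus h)) (𝓝 0) (𝓝 0) := by
  have h := (tendsto_integral_norm_comp_add_sub integrable_whithamKernel).sqrt
  rwa [sqrt_zero] at h

lemma abs_Lop_sub_Lop_le {f : ℝ → ℝ} (hf : Continuous f) (hC : ∀ y, |f y| ≤ 1) (x y : ℝ) :
    |Lop whithamKernel f x - Lop whithamKernel f y| ≤ whithamModulus (x - y) := by
  have hx := integrable_whithamKernel_sub_mul hf hC x
  have hy := integrable_whithamKernel_sub_mul hf hC y
  have h := integral_sub_left_eq_self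
    (fun z => |whithamKernel (x - y + z) - whithamKernel z|) volume y
  rw [Lop, Lop, ← integral_sub hx hy, whithamModulus, ← h]
  refine (abs_integral_le_integral_abs).trans (integral_mono_ae (hx.sub hy).abs ?_
    (ae_of_all _ fun z => ?_))
  · have hi := ((integrable_whithamKernel.comp_add_left (x - y)).sub
      integrable_whithamKernel).abs.comp_sub_left y
    exact hi
  · simp only
    rw [← sub_mul, abs_mul, show x - y + (y - z) = x - z by ring]
    exact mul_le_of_le_one_right (abs_nonneg _) (hC z)

lemma tendsto_Lop_of_tendsto {K : ℝ → ℝ} (hK : Integrable K) {F : ℕ → ℝ → ℝ} {f : ℝ → ℝ} {C : ℝ}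
    (hF : ∀ n, Continuous (F n)) (hC : ∀ n y, |F n y| ≤ C)
    (hlim : ∀ y, Tendsto (fun n => F n y) atTop (𝓝 (f y))) (x : ℝ) :
    Tendsto (fun n => Lop K (F n) x) atTop (𝓝 (Lop K f x)) := by
  have hKx := hK.comp_sub_left x
  refine tendsto_integral_of_dominated_convergence (fun y => |K (x - y)| * C)
    (fun n => hKx.aestronglyMeasurable.mul (hF n).aestronglyMeasurable) (hKx.abs.mul_const C)
    (fun n => ae_of_all _ fun y => ?_) (ae_of_all _ fun y => (hlim y).const_mul _)
  rw [norm_mul, norm_eq_abs, norm_eq_abs]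
  exact mul_le_mul_of_nonneg_left (hC n y) (abs_nonneg _)

/-- Arzelà–Ascoli on the line for a family with a common bound and modulus of continuity. -/
lemma isCompact_setOf_bound_and_modulus {C : ℝ} {ω : ℝ → ℝ} (hω : Tendsto ω (𝓝 0) (𝓝 0)) :
    IsCompact {f : C(ℝ, ℝ) | (∀ x, |f x| ≤ C) ∧ ∀ x y, |f x - f y| ≤ ω (x - y)} := by
  have hlim : ∀ x : ℝ, Tendsto (fun y => ω (x - y)) (𝓝 x) (𝓝 0) := fun x =>
    hω.comp (by simpa using (tendsto_const_nhds (x := x)).sub (tendsto_id (x := 𝓝 x)))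
  have hcont : ∀ f : ℝ → ℝ, (∀ x y, |f x - f y| ≤ ω (x - y)) → Continuous f := fun f hf =>
    continuous_iff_continuousAt.2 fun x => by
      rw [ContinuousAt, tendsto_iff_dist_tendsto_zero]
      refine squeeze_zero (fun _ => dist_nonneg) (fun y => ?_) (hlim x)
      rw [dist_comm, dist_eq]
      exact hf x y
  refine ArzelaAscoli.isCompact_of_equicontinuous _ ?_ ?_
  · have himg : ContinuousMap.toFun '' {f : C(ℝ, ℝ) | (∀ x, |f x| ≤ C) ∧
        ∀ x y, |f x - f y| ≤ ω (x - y)} =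
        (Set.univ.pi fun _ => Set.Icc (-C) C) ∩ {f | ∀ x y, |f x - f y| ≤ ω (x - y)} := by
      ext f
      constructor
      · rintro ⟨g, ⟨h1, h2⟩, rfl⟩
        exact ⟨fun x _ => abs_le.1 (h1 x), h2⟩
      · rintro ⟨h1, h2⟩
        exact ⟨⟨f, hcont f h2⟩, ⟨fun x => abs_le.2 (h1 x trivial), h2⟩, rfl⟩
    rw [himg]
    refine (isCompact_univ_pi fun _ => isCompact_Icc).inter_right ?_
    simp only [Set.ofPred_forall]
    exact isClosed_iInter fun x => isClosed_iInter fun y => isClosed_le (by fun_prop) (by fun_prop)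
  · refine fun x => Metric.equicontinuousAt_of_continuity_modulus _ (hlim x) _ ?_
    refine Eventually.of_forall fun y f => ?_
    rw [dist_eq]
    exact f.2.2 x y

lemma StrictMonoOn.Icc_of_Ioo_of_continuous {f : ℝ → ℝ} {a b : ℝ}
    (h : StrictMonoOn f (Set.Ioo a b)) (hf : Continuous f) : StrictMonoOn f (Set.Icc a b) := by
  intro x hx y hy hxy
  obtain ⟨c, hxc, hcy⟩ := exists_between hxy
  obtain ⟨d, hcd, hdy⟩ := exists_between hcy
  have hc : c ∈ Set.Ioo a b := ⟨hx.1.trans_lt hxc, hcy.trans_le hy.2⟩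
  have hd : d ∈ Set.Ioo a b := ⟨hc.1.trans hcd, hdy.trans_le hy.2⟩
  have h1 : f x ≤ f c := by
    refine le_of_tendsto (hf.continuousWithinAt (s := Set.Ioi x)) ?_
    filter_upwards [Ioo_mem_nhdsGT hxc] with t ht
    exact (h ⟨hx.1.trans_lt ht.1, ht.2.trans hc.2⟩ hc ht.2).le
  have h2 : f d ≤ f y := by
    refine ge_of_tendsto (hf.continuousWithinAt (s := Set.Iio y)) ?_
    filter_upwards [Ioo_mem_nhdsLT hdy] with t ht
    exact (h hd ⟨hd.1.trans ht.1, ht.2.trans_le hy.2⟩ ht.1).le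
  exact h1.trans_lt ((h hc hd hcd).trans_le h2)

/-- An even continuous `P`-periodic solution of the steady Whitham equation with speed `μ`,
strictly monotone on half-periods, lying below the height `μ / 2`. -/
structure IsPeriodicWhithamWave (P μ : ℝ) (φ : ℝ → ℝ) : Prop where
  speed_mem : μ ∈ Set.Ioc (0 : ℝ) 1
  continuous : Continuous φ
  periodic : Function.Periodic φ P
  solution : ∀ x, -μ * φ x + Lop whithamKernel φ x + φ x ^ 2 = 0
  even : ∀ x, φ (-x) = φ x
  strictMonoOn : StrictMonoOn φ (Set.Ioo (-(P / 2)) 0)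
  sub_one_le : ∀ x, μ - 1 ≤ φ x
  le_half : ∀ x, φ x ≤ μ / 2

namespace IsPeriodicWhithamWave

variable {P μ : ℝ} {φ : ℝ → ℝ}

lemma abs_le_one (h : IsPeriodicWhithamWave P μ φ) (x : ℝ) : |φ x| ≤ 1 :=
  abs_le.2 ⟨by linarith [h.sub_one_le x, h.speed_mem.1], by linarith [h.le_half x, h.speed_mem.2]⟩

lemma sq_eq (h : IsPeriodicWhithamWave P μ φ) (x : ℝ) :
    (μ / 2 - φ x) ^ 2 = μ ^ 2 / 4 - Lop whithamKernel φ x := by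
  linarith [h.solution x]

lemma abs_sub_le (h : IsPeriodicWhithamWave P μ φ) (x y : ℝ) :
    |φ x - φ y| ≤ √(whithamModulus (x - y)) := by
  refine abs_le_sqrt (le_trans ?_ (abs_Lop_sub_Lop_le h.continuous h.abs_le_one x y))
  have hx := h.le_half x
  have hy := h.le_half y
  have e : Lop whithamKernel φ x - Lop whithamKernel φ y =
      (φ x - φ y) * ((μ / 2 - φ x) + (μ / 2 - φ y)) := by
    linarith [h.sq_eq x, h.sq_eq y]
  rw [e, abs_mul, ← sq_abs, sq, abs_of_nonneg (a := _ + _) (by linarith)]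
  refine mul_le_mul_of_nonneg_left (abs_le.2 ⟨?_, ?_⟩) (abs_nonneg _) <;> linarith

lemma strictMonoOn_Icc (h : IsPeriodicWhithamWave P μ φ) :
    StrictMonoOn φ (Set.Icc (-(P / 2)) 0) :=
  h.strictMonoOn.Icc_of_Ioo_of_continuous h.continuous

lemma strictAntiOn (h : IsPeriodicWhithamWave P μ φ) : StrictAntiOn φ (Set.Icc 0 (P / 2)) := by
  intro x hx y hy hxy
  rw [← h.even x, ← h.even y]
  exact h.strictMonoOn_Icc ⟨by linarith [hy.2], by linarith [hy.1]⟩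
    ⟨by linarith [hx.2], by linarith [hx.1]⟩ (by linarith)

lemma apply_abs (h : IsPeriodicWhithamWave P μ φ) (x : ℝ) : φ |x| = φ x := by
  rcases abs_choice x with e | e <;> simp [e, h.even]

lemma sub_nonneg_of_mem (h : IsPeriodicWhithamWave P μ φ) (hP : 6 ≤ P) {y : ℝ}
    (hy : y ∈ Set.Icc 0 (P / 2)) : 0 ≤ φ (y - 1) - φ (y + 1) := by
  obtain ⟨hy0, hy1⟩ := hy
  rw [sub_nonneg, ← h.apply_abs (y - 1)]
  have habs : |y - 1| ≤ y + 1 := abs_le.2 ⟨by linarith, by linarith⟩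
  rcases le_total (y + 1) (P / 2) with hle | hle
  · exact h.strictAntiOn.antitoneOn ⟨abs_nonneg _, habs.trans hle⟩ ⟨by linarith, hle⟩ habs
  · rw [← h.even (y + 1), ← h.periodic (-(y + 1))]
    have habs' : |y - 1| ≤ -(y + 1) + P := abs_le.2 ⟨by linarith, by linarith⟩
    exact h.strictAntiOn.antitoneOn ⟨abs_nonneg _, habs'.trans (by linarith)⟩
      ⟨by linarith, by linarith⟩ habs'

/-- Away from the crest, waves of large period stay uniformly below `μ / 2`. -/
lemma le_half_sub_apply_three (h : IsPeriodicWhithamWave P μ φ) (hP : 6 ≤ P) {δ : ℝ}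
    (hδ0 : 0 ≤ δ) (hδ : δ ≤ whithamKernel 1 - whithamKernel 2 - whithamKernel (P - 4)) :
    δ / 2 ≤ μ / 2 - φ 3 := by
  set D : ℝ → ℝ := fun y => φ (y - 1) - φ (y + 1) with hD
  have hc := h.continuous
  have hDc : Continuous D := by fun_prop
  have hDb : ∀ y, |D y| ≤ 2 := fun y => (abs_sub _ _).trans (by
    linarith [h.abs_le_one (y - 1), h.abs_le_one (y + 1)])
  have hDodd : ∀ y, D (-y) = -D y := fun y => by
    simp only [hD]
    rw [← h.even (-y - 1), ← h.even (-y + 1)]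
    ring_nf
  have hDper : Function.Periodic D P := fun y => by
    simp only [hD]
    rw [← h.periodic (y - 1), ← h.periodic (y + 1)]
    ring_nf
  obtain ⟨x, hx, hmin⟩ := isCompact_Icc.exists_isMinOn (Set.nonempty_Icc.2 (one_le_two (α := ℝ)))
    hDc.continuousOn
  have hL := mul_integral_le_Lop_whithamKernel hDc hDb hDodd hDper hP
    (fun y hy => h.sub_nonneg_of_mem hP hy) hx
  have hmem3 : (3 : ℝ) ∈ Set.Icc 0 (P / 2) := ⟨by norm_num, by linarith⟩
  have hm1 : x - 1 ∈ Set.Icc 0 (P / 2) := ⟨by linarith [hx.1], by linarith [hx.2]⟩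
  have hp1 : x + 1 ∈ Set.Icc 0 (P / 2) := ⟨by linarith [hx.1], by linarith [hx.2]⟩
  have hDx : 0 < D x := sub_pos.2 (h.strictAntiOn hm1 hp1 (by linarith))
  have hint : D x ≤ ∫ y in (1 : ℝ)..2, D y := by
    have := intervalIntegral.integral_mono_on (a := 1) (b := 2) (μ := volume) (f := fun _ => D x)
      one_le_two (by simp) (hDc.intervalIntegrable 1 2) fun y hy => hmin hy
    simpa [show (2 : ℝ) - 1 = 1 by norm_num] using this
  have hLD : Lop whithamKernel D x =
      Lop whithamKernel φ (x - 1) - Lop whithamKernel φ (x + 1) := by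
    rw [Lop_sub (f := fun y => φ (y - 1)) (g := fun y => φ (y + 1)) (by fun_prop) (by fun_prop)
      (fun y => h.abs_le_one _) (fun y => h.abs_le_one _), Lop_comp_add_right]
    simp only [sub_eq_add_neg, Lop_comp_add_right]
  have hfac : Lop whithamKernel D x =
      ((μ / 2 - φ (x - 1)) + (μ / 2 - φ (x + 1))) * D x := by
    rw [hLD]
    simp only [hD]
    linarith [h.sq_eq (x - 1), h.sq_eq (x + 1)]
  have h3m := h.strictAntiOn.antitoneOn hm1 hmem3 (by linarith [hx.2])
  have h3p := h.strictAntiOn.antitoneOn hp1 hmem3 (by linarith [hx.2])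
  have hle : δ * D x ≤ ((μ / 2 - φ (x - 1)) + (μ / 2 - φ (x + 1))) * D x := by
    rw [← hfac]
    exact (mul_le_mul hδ hint hDx.le (hδ0.trans hδ)).trans hL
  linarith [le_of_mul_le_mul_right hle hDx]

end IsPeriodicWhithamWave

lemma eventually_half_gap_le {P : ℕ → ℝ} (hP : Tendsto P atTop atTop) :
    ∀ᶠ n in atTop, (whithamKernel 1 - whithamKernel 2) / 2 ≤
      whithamKernel 1 - whithamKernel 2 - whithamKernel (P n - 4) := by
  have hgap : 0 < (whithamKernel 1 - whithamKernel 2) / 2 := half_pos (sub_pos.2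
    (whithamKernel_strictAntiOn (Set.mem_Ioi.2 one_pos) (Set.mem_Ioi.2 two_pos) one_lt_two))
  have hlim : Tendsto (fun n => (2 * (P n - 4))⁻¹) atTop (𝓝 0) :=
    ((tendsto_atTop_add_const_right _ (-4) hP).const_mul_atTop two_pos).inv_tendsto_atTop
  filter_upwards [hlim.eventually_le_const hgap, hP.eventually_gt_atTop 4] with n hn h4
  have hpos : 0 < P n - 4 := by linarith
  have := whithamKernel_le hpos.ne'
  rw [abs_of_pos hpos] at this
  linarith

section LimitWave

variable {ψ : ℝ → ℝ}

lemma eq_apply_zero_of_periodic {T : ℝ} (hT : 0 < T) (hper : Function.Periodic ψ T)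
    (heven : ∀ x, ψ (-x) = ψ x) (hmono : MonotoneOn ψ (Set.Iic 0)) (x : ℝ) : ψ x = ψ 0 := by
  have hneg : ∀ x ≤ 0, ψ x = ψ 0 := fun x hx => by
    refine le_antisymm (hmono hx Set.self_mem_Iic hx) ?_
    obtain ⟨n, hn⟩ := exists_nat_ge (-x / T)
    rw [div_le_iff₀ hT] at hn
    have h1 := hper.sub_nat_mul_eq n (x := 0)
    rw [← h1]
    exact hmono (by rw [Set.mem_Iic]; have : 0 ≤ n * T := by positivity
                    linarith) hx (by linarith)
  rcases le_total x 0 with hx | hx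
  · exact hneg x hx
  · rw [← heven]
    exact hneg _ (by linarith)

lemma periodic_of_Lop_eq (hc : Continuous ψ) {C : ℝ} (hb : ∀ x, |ψ x| ≤ C)
    (heven : ∀ x, ψ (-x) = ψ x) (hmono : MonotoneOn ψ (Set.Iic 0)) {x y : ℝ} (hxy : x < y)
    (hy : y ≤ 0) (hL : Lop whithamKernel ψ x = Lop whithamKernel ψ y) :
    Function.Periodic ψ (-(x + y)) := by
  set a := (x + y) / 2 with ha
  have ha0 : a < 0 := by linarith
  have habs : ∀ x, ψ x = ψ (-|x|) := fun x => by
    rcases abs_choice x with e | e <;> simp [e, heven]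
  have hzero := eq_zero_of_Lop_whithamKernel_eq_zero
    (f := fun t => ψ (t + a) - ψ (a - t)) (C := C + C) (by fun_prop)
    (fun t => (abs_sub _ _).trans (add_le_add (hb _) (hb _)))
    (fun t => by rw [neg_add_eq_sub, sub_neg_eq_add, add_comm a t]; ring)
    (fun t ht => by
      rw [sub_nonneg, habs (t + a), habs (a - t)]
      refine hmono (Set.mem_Iic.2 (neg_nonpos.2 (abs_nonneg _)))
        (Set.mem_Iic.2 (neg_nonpos.2 (abs_nonneg _))) (neg_le_neg ?_)
      rw [abs_of_neg (by linarith : a - t < 0), abs_le]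
      constructor <;> linarith)
    (x := (y - x) / 2) (by linarith)
    (by
      rw [Lop_sub (f := fun t => ψ (t + a)) (g := fun t => ψ (a - t)) (by fun_prop) (by fun_prop)
        (fun t => hb _) (fun t => hb _), Lop_comp_add_right, Lop_whithamKernel_comp_sub_left, ha,
        show (y - x) / 2 + (x + y) / 2 = y by ring, show (x + y) / 2 - (y - x) / 2 = x by ring,
        hL, sub_self])
  intro t
  have h := hzero (t - a)
  rw [sub_add_cancel, sub_eq_zero, ← heven (a - (t - a))] at h
  rw [h, ha]
  ring_nf

lemma strictMonoOn_of_solution (hc : Continuous ψ) {C ν : ℝ} (hb : ∀ x, |ψ x| ≤ C)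
    (hsol : ∀ x, -ν * ψ x + Lop whithamKernel ψ x + ψ x ^ 2 = 0) (heven : ∀ x, ψ (-x) = ψ x)
    (hmono : MonotoneOn ψ (Set.Iic 0)) (hne : ∃ x y, ψ x ≠ ψ y) :
    StrictMonoOn ψ (Set.Iic 0) := by
  intro x hx y hy hxy
  refine lt_of_le_of_ne (hmono hx hy hxy.le) fun he => ?_
  have hL : Lop whithamKernel ψ x = Lop whithamKernel ψ y := by
    have h1 := hsol x
    rw [he] at h1
    linarith [hsol y]
  rw [Set.mem_Iic] at hx hy
  have hconst := eq_apply_zero_of_periodic (by linarith)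
    (periodic_of_Lop_eq hc hb heven hmono hxy hy hL) heven hmono
  obtain ⟨u, v, huv⟩ := hne
  exact huv ((hconst u).trans (hconst v).symm)

lemma exists_ne_of_solution {ν lam : ℝ} (hlam : 0 < lam) (hν : 0 ≤ ν)
    (hsol : ∀ x, -ν * ψ x + Lop whithamKernel ψ x + ψ x ^ 2 = 0) (h0 : ψ 0 = lam * ν / 2)
    {z : ℝ} (hz : ψ z < ν / 2) (hν1 : ν ≤ 1) : ∃ x y, ψ x ≠ ψ y := by
  by_contra! hconst
  have hψ : ψ = fun _ => lam * ν / 2 := funext fun x => (hconst x 0).trans h0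
  have h := hsol 0
  rw [hψ, Lop_whithamKernel_const] at h
  rw [hψ] at hz
  have hc : 0 ≤ lam * ν / 2 := by positivity
  have hfac : lam * ν / 2 * (1 - ν + lam * ν / 2) = 0 := by linarith
  have hc0 : lam * ν / 2 = 0 := by
    rcases mul_eq_zero.1 hfac with h | h <;> linarith
  have : ν = 0 := by
    rcases mul_eq_zero.1 (show lam * ν = 0 by linarith) with h | h <;> linarith
  simp only [this] at hz
  linarith

end LimitWave

lemma not_periodic_of_strictMonoOn {ψ : ℝ → ℝ} (h : StrictMonoOn ψ (Set.Iic 0)) :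
    ¬ ∃ T : ℝ, 0 < T ∧ Function.Periodic ψ T := by
  rintro ⟨T, hT, hper⟩
  have h1 := h (show -T ∈ Set.Iic 0 by simpa using hT.le) Set.self_mem_Iic (by linarith)
  have h2 := hper (-T)
  rw [neg_add_cancel] at h2
  exact h1.ne h2.symm

end

theorem periodic_waves_converge_to_limit_wave
    (lam : ℝ) (hlam : lam ∈ Set.Ioc (0:ℝ) 1)
    (P : ℕ → ℝ) (hP : ∀ n, 0 < P n) (hPtop : Tendsto P atTop atTop)
    (μ : ℕ → ℝ) (hμ : ∀ n, μ n ∈ Set.Ioc (0:ℝ) 1)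
    (φ : ℕ → ℝ → ℝ)
    (hcont : ∀ n, Continuous (φ n))
    (hper : ∀ n, Function.Periodic (φ n) (P n))
    (hsol : ∀ n, ∀ x : ℝ, -(μ n) * φ n x + Lop whithamKernel (φ n) x + (φ n x) ^ 2 = 0)
    (heven : ∀ n, ∀ x : ℝ, φ n (-x) = φ n x)
    (hmono : ∀ n, StrictMonoOn (φ n) (Set.Ioo (-(P n / 2)) 0))
    (hbounds : ∀ n, ∀ x : ℝ, μ n - 1 ≤ φ n x ∧ φ n x ≤ φ n 0)
    (hheight : ∀ n, φ n 0 = lam * μ n / 2) :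
    ∃ (k : ℕ → ℕ) (ν : ℝ) (ψ : ℝ → ℝ),
      StrictMono k ∧
      ν ∈ Set.Icc (0:ℝ) 1 ∧
      Continuous ψ ∧
      Tendsto (fun j => μ (k j)) atTop (nhds ν) ∧
      (∀ C : Set ℝ, IsCompact C → TendstoUniformlyOn (fun j => φ (k j)) ψ atTop C) ∧
      (∀ x : ℝ, -ν * ψ x + Lop whithamKernel ψ x + (ψ x) ^ 2 = 0) ∧
      (∀ x : ℝ, ν - 1 ≤ ψ x ∧ ψ x ≤ lam * ν / 2) ∧
      ψ 0 = lam * ν / 2 ∧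
      (∀ x : ℝ, ψ (-x) = ψ x) ∧
      (∃ x y : ℝ, ψ x ≠ ψ y) ∧
      (¬ ∃ T : ℝ, 0 < T ∧ Function.Periodic ψ T) ∧
      StrictMonoOn ψ (Set.Iic (0:ℝ)) := by
  have hwave : ∀ n, IsPeriodicWhithamWave (P n) (μ n) (φ n) := fun n =>
    { speed_mem := hμ n
      continuous := hcont n
      periodic := hper n
      solution := hsol n
      even := heven n
      strictMonoOn := hmono n
      sub_one_le := fun x => (hbounds n x).1
      le_half := fun x => by
        have := hheight n ▸ (hbounds n x).2
        have := mul_le_mul_of_nonneg_right hlam.2 (hμ n).1.le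
        linarith }
  have hcompact := (isCompact_Icc (a := (0 : ℝ)) (b := 1)).prod
    (isCompact_setOf_bound_and_modulus (C := 1) tendsto_sqrt_whithamModulus)
  obtain ⟨⟨ν, ψ⟩, ⟨hν, -, hψmod⟩, k, hk, hlim⟩ := hcompact.isSeqCompact
    (x := fun n => (μ n, (⟨φ n, hcont n⟩ : C(ℝ, ℝ))))
    fun n => ⟨⟨(hμ n).1.le, (hμ n).2⟩, (hwave n).abs_le_one, (hwave n).abs_sub_le⟩
  have hμlim : Tendsto (fun j => μ (k j)) atTop (nhds ν) := (Prod.tendsto_iff _ _).1 hlim |>.1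
  have hφlim := ((Prod.tendsto_iff _ _).1 hlim).2
  have hunif : ∀ C : Set ℝ, IsCompact C → TendstoUniformlyOn (fun j => φ (k j)) ψ atTop C :=
    ContinuousMap.tendsto_iff_forall_isCompact_tendstoUniformlyOn.1 hφlim
  have hpt : ∀ x, Tendsto (fun j => φ (k j) x) atTop (nhds (ψ x)) := fun x =>
    (hunif {x} isCompact_singleton).tendsto_at rfl
  have hψb : ∀ x, |ψ x| ≤ 1 := fun x =>
    le_of_tendsto' (hpt x).abs fun j => (hwave (k j)).abs_le_one x
  have hPk : Tendsto (fun j => P (k j)) atTop atTop := hPtop.comp hk.tendsto_atTop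
  have hψsol : ∀ x : ℝ, -ν * ψ x + Lop whithamKernel ψ x + (ψ x) ^ 2 = 0 := fun x => by
    refine tendsto_nhds_unique (((hμlim.neg.mul (hpt x)).add
      (tendsto_Lop_of_tendsto integrable_whithamKernel (fun j => hcont (k j))
        (fun j => (hwave (k j)).abs_le_one) hpt x)).add ((hpt x).pow 2)) ?_
    exact tendsto_const_nhds.congr fun j => (hsol (k j) x).symm
  have hheightlim : Tendsto (fun j => lam * μ (k j) / 2) atTop (nhds (lam * ν / 2)) :=
    (hμlim.const_mul lam).div_const 2
  have hψ0 : ψ 0 = lam * ν / 2 :=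
    tendsto_nhds_unique (hpt 0) (hheightlim.congr fun j => (hheight (k j)).symm)
  have hψeven : ∀ x : ℝ, ψ (-x) = ψ x := fun x =>
    tendsto_nhds_unique (hpt (-x)) ((hpt x).congr fun j => (heven (k j) x).symm)
  have hψmono : MonotoneOn ψ (Set.Iic 0) := fun x hx y hy hxy => by
    refine le_of_tendsto_of_tendsto (hpt x) (hpt y) ?_
    filter_upwards [hPk.eventually_ge_atTop (-x * 2)] with j hj
    exact (hwave (k j)).strictMonoOn_Icc.monotoneOn ⟨by linarith, hx⟩ ⟨by linarith, hy⟩ hxy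
  have hgap : 0 < whithamKernel 1 - whithamKernel 2 := sub_pos.2
    (whithamKernel_strictAntiOn (Set.mem_Ioi.2 one_pos) (Set.mem_Ioi.2 two_pos) one_lt_two)
  have hψ3 : (whithamKernel 1 - whithamKernel 2) / 2 / 2 ≤ ν / 2 - ψ 3 := by
    refine ge_of_tendsto ((hμlim.div_const 2).sub (hpt 3)) ?_
    filter_upwards [hPk.eventually_ge_atTop 6, eventually_half_gap_le hPk] with j hj hδ
    exact (hwave (k j)).le_half_sub_apply_three hj (by linarith) hδ
  have hne : ∃ x y : ℝ, ψ x ≠ ψ y :=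
    exists_ne_of_solution hlam.1 hν.1 hψsol hψ0 (z := 3) (by linarith) hν.2
  have hstrict := strictMonoOn_of_solution ψ.continuous hψb hψsol hψeven hψmono hne
  exact ⟨k, ν, ψ, hk, hν, ψ.continuous, hμlim, hunif, hψsol,
    fun x => ⟨le_of_tendsto_of_tendsto' (hμlim.sub_const 1) (hpt x) fun j =>
        (hbounds (k j) x).1,
      le_of_tendsto_of_tendsto' (hpt x) hheightlim fun j =>
        (hbounds (k j) x).2.trans_eq (hheight (k j))⟩,
    hψ0, hψeven, hne, not_periodic_of_strictMonoOn hstrict, hstrict⟩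
end

section
/- Let K : ℝ → ℝ be strictly positive, measurable and integrable with ∫_ℝ K = 1. Let φ and φ̃ be continuous solutions of the steady Whitham equation (relative to K) with wave speeds μ and μ̃ respectively, where μ, μ̃ ∈ (1,2) and μ ≥ μ̃, and suppose 0 < φ(x) ≤ μ/2 and 0 < φ̃(x) ≤ μ̃/2 for all x ∈ ℝ. If φ̃(x) ≥ φ(x) for all x ∈ ℝ and φ̃(x₀) = φ(x₀) for some x₀ ∈ ℝ, then φ̃(x) = φ(x) for all x ∈ ℝ. -/
open Real Filter MeasureTheory

/-- A solution of the steady Whitham equation with wave speed `μ`, relative to the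
kernel `K`: a bounded measurable `φ` satisfying `−μφ + Lφ + φ² = 0` pointwise. -/
def IsSolution (K : ℝ → ℝ) (μ : ℝ) (φ : ℝ → ℝ) : Prop :=
  Measurable φ ∧ (∃ C : ℝ, ∀ x : ℝ, |φ x| ≤ C) ∧
    ∀ x : ℝ, -μ * φ x + Lop K φ x + (φ x) ^ 2 = 0
/-- If a continuous nonnegative function has nonpositive convolution with a positive kernel at one
point, it vanishes identically. -/
theorem eq_zero_of_Lop_nonpos {K f : ℝ → ℝ} (hKpos : ∀ x, 0 < K x) (hf : Continuous f)
    (hf0 : ∀ x, 0 ≤ f x) {x₀ : ℝ} (hint : Integrable fun y => K (x₀ - y) * f y)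
    (hL : Lop K f x₀ ≤ 0) : ∀ x, f x = 0 := by
  have hnn : ∀ y, 0 ≤ K (x₀ - y) * f y := fun y => mul_nonneg (hKpos _).le (hf0 y)
  have hae : (fun y => K (x₀ - y) * f y) =ᵐ[volume] 0 :=
    (integral_eq_zero_iff_of_nonneg hnn hint).1 (le_antisymm hL (integral_nonneg hnn))
  have hfae : f =ᵐ[volume] fun _ => 0 := by
    filter_upwards [hae] with y hy
    exact (mul_eq_zero.1 hy).resolve_left (hKpos _).ne'
  exact fun x => congrFun ((hf.ae_eq_iff_eq volume continuous_const).1 hfae) x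

/-- The integrand defining `Lop K f` is integrable for integrable `K` and bounded continuous `f`. -/
theorem integrable_Lop_integrand {K f : ℝ → ℝ} (hK : Integrable K) (hf : Continuous f)
    (hbdd : ∃ C : ℝ, ∀ x, |f x| ≤ C) (x : ℝ) : Integrable fun y => K (x - y) * f y := by
  obtain ⟨C, hC⟩ := hbdd
  exact (hK.comp_sub_left x).mul_bdd hf.aestronglyMeasurable (.of_forall hC)

theorem touching_lemma (K : ℝ → ℝ)
    (hKmeas : Measurable K) (hKpos : ∀ x : ℝ, 0 < K x)
    (hKint : Integrable K) (hKone : (∫ x : ℝ, K x) = 1)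
    (φ φt : ℝ → ℝ) (μ μt : ℝ)
    (hμ : μ ∈ Set.Ioo (1:ℝ) 2) (hμt : μt ∈ Set.Ioo (1:ℝ) 2) (hμge : μt ≤ μ)
    (hφcont : Continuous φ) (hφtcont : Continuous φt)
    (hφ : IsSolution K μ φ) (hφt : IsSolution K μt φt)
    (hφrange : ∀ x : ℝ, 0 < φ x ∧ φ x ≤ μ / 2)
    (hφtrange : ∀ x : ℝ, 0 < φt x ∧ φt x ≤ μt / 2)
    (hle : ∀ x : ℝ, φ x ≤ φt x)
    (x₀ : ℝ) (heq : φt x₀ = φ x₀) :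
    ∀ x : ℝ, φt x = φ x := by
  have hi := integrable_Lop_integrand hKint hφcont hφ.2.1 x₀
  have hit := integrable_Lop_integrand hKint hφtcont hφt.2.1 x₀
  have hsplit : (fun y => K (x₀ - y) * (φt y - φ y)) =
      fun y => K (x₀ - y) * φt y - K (x₀ - y) * φ y := funext fun y => mul_sub _ _ _
  have hL : Lop K (fun y => φt y - φ y) x₀ = Lop K φt x₀ - Lop K φ x₀ := by
    unfold Lop
    rw [hsplit, integral_sub hit hi]
  have hLnonpos : Lop K (fun y => φt y - φ y) x₀ ≤ 0 := by
    have h := hφ.2.2 x₀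
    have ht := hφt.2.2 x₀
    rw [heq] at ht
    rw [hL]
    linarith [mul_le_mul_of_nonneg_right hμge (hφrange x₀).1.le]
  intro x
  exact sub_eq_zero.1 (eq_zero_of_Lop_nonpos hKpos (hφtcont.sub hφcont)
    (fun y => sub_nonneg.2 (hle y)) (hsplit ▸ hit.sub hi) hLnonpos x)
end
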